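/- Let m ≥ 3 and set N = (m²)!·(1!·2!⋯(m−1)!) / (m!·(m+1)!⋯(2m−1)!) (the degree of the Wronski map on Gr(m, ℂ_{2m−1}[t])). Let Φ be a nonzero real polynomial of degree at most m², and let S be the set of m-dimensional ℂ-linear subspaces H of the space of complex polynomials of degree at most 2m−1 such that the Wronskian of some (equivalently, any) basis of H is a nonzero complex scalar multiple of Φ. If S is finite with exactly N elements (so that every point of the fiber has multiplicity one), then the number of subspaces H ∈ S that are mapped onto themselves by coefficientwise complex conjugation is congruent to N modulo 4. -/

import Mathlib

open Polynomial

/-- The Wronskian of `m` polynomials: the determinant of the `m × m` matrix whose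
`(i,j)` entry is the `(i-1)`-st derivative of `f j`. -/
noncomputable def Wr {K : Type*} [CommRing K] {m : ℕ} (f : Fin m → K[X]) : K[X] :=
  (Matrix.of fun i j : Fin m => (derivative^[(i : ℕ)] (f j))).det

theorem exists_ringHom_extending {R S Ω : Type*} [CommRing R] [CommRing S] [Algebra R S]
    [Algebra.IsIntegral R S] (hinj : Function.Injective (algebraMap R S)) [Field Ω]
    [IsAlgClosed Ω] (f : R →+* Ω) : ∃ g : S →+* Ω, g.comp (algebraMap R S) = f := by
  have hP : (RingHom.ker f).IsPrime := RingHom.ker_isPrime f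
  obtain ⟨Q, -, hQ, hQP⟩ := Ideal.exists_ideal_over_prime_of_isIntegral (S := S) (RingHom.ker f) ⊥
    (by rw [Ideal.comap_bot_of_injective _ hinj]; exact bot_le)
  have : Q.LiesOver (RingHom.ker f) := ⟨hQP.symm⟩
  have hf : Function.Injective (RingHom.kerLift f) := RingHom.kerLift_injective f
  let : Algebra (R ⧸ RingHom.ker f) Ω := (RingHom.kerLift f).toAlgebra
  have : IsDomain (R ⧸ RingHom.ker f) := Ideal.Quotient.isDomain _
  have : IsDomain (S ⧸ Q) := Ideal.Quotient.isDomain _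
  have : Module.IsTorsionFree (R ⧸ RingHom.ker f) Ω :=
    Module.isTorsionFree_iff_algebraMap_injective.2 hf
  have : FaithfulSMul (R ⧸ RingHom.ker f) (S ⧸ Q) :=
    Ideal.Quotient.instFaithfulSMul _ _
  have : Module.IsTorsionFree (R ⧸ RingHom.ker f) (S ⧸ Q) :=
    Module.isTorsionFree_iff_faithfulSMul.2 this
  have : Algebra.IsIntegral (R ⧸ RingHom.ker f) (S ⧸ Q) := inferInstance
  have : Algebra.IsAlgebraic (R ⧸ RingHom.ker f) (S ⧸ Q) := Algebra.IsIntegral.isAlgebraic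
  let g : S ⧸ Q →ₐ[R ⧸ RingHom.ker f] Ω := IsAlgClosed.lift
  refine ⟨g.toRingHom.comp (Ideal.Quotient.mk Q), RingHom.ext fun r => ?_⟩
  have := g.commutes (Ideal.Quotient.mk _ r)
  exact this

section Points

variable {A B : Type*} [CommRing A] [IsDomain A] [IsIntegrallyClosed A] [CommRing B] [IsDomain B]
  [Algebra A B] [Algebra.IsIntegral A B] [Module.IsTorsionFree A B]

theorem exists_ringHom_of_isRoot_minpoly {Ω : Type*} [Field Ω] [IsAlgClosed Ω] (w : A →+* Ω)
    (s : B) (z : Ω) (hz : ((minpoly A s).map w).eval z = 0) :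
    ∃ x : B →+* Ω, x.comp (algebraMap A B) = w ∧ x s = z := by
  have hs : IsIntegral A s := Algebra.IsIntegral.isIntegral s
  let e := minpoly.equivAdjoin hs
  let f : Algebra.adjoin A {s} →+* Ω :=
    (AdjoinRoot.lift w z (by rwa [eval_map] at hz)).comp e.symm.toAlgHom.toRingHom
  have : Algebra.IsIntegral (Algebra.adjoin A {s}) B := Algebra.IsIntegral.tower_top A
  obtain ⟨x, hx⟩ := exists_ringHom_extending (S := B) Subtype.val_injective f
  refine ⟨x, RingHom.ext fun a => ?_, ?_⟩
  · have := RingHom.congr_fun hx (algebraMap A _ a)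
    have h2 : e.symm (algebraMap A _ a) = algebraMap A _ a := e.symm.commutes a
    simp only [RingHom.comp_apply, f] at this ⊢
    rw [IsScalarTower.algebraMap_apply A (Algebra.adjoin A {s}) B, this]
    change AdjoinRoot.lift w z _ (e.symm (algebraMap A _ a)) = _
    rw [h2]
    exact AdjoinRoot.lift_of _
  · have := RingHom.congr_fun hx ⟨s, Algebra.subset_adjoin rfl⟩
    have h2 : e.symm ⟨s, Algebra.subset_adjoin rfl⟩ = AdjoinRoot.root _ := by
      rw [AlgEquiv.symm_apply_eq]
      apply Subtype.ext
      simp [e]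
    simp only [RingHom.comp_apply, f] at this
    change x s = AdjoinRoot.lift w z _ (e.symm ⟨s, Algebra.subset_adjoin rfl⟩) at this
    rw [this, h2]
    exact AdjoinRoot.lift_root _

end Points

section Norm

variable {A B : Type*} (K L : Type*) [CommRing A] [IsDomain A] [IsIntegrallyClosed A] [CommRing B]
  [IsDomain B] [IsIntegrallyClosed B] [Algebra A B] [Algebra.IsIntegral A B]
  [Module.IsTorsionFree A B] [Field K] [Field L] [Algebra A K] [IsFractionRing A K] [Algebra B L]
  [IsFractionRing B L] [Algebra A L] [Algebra K L] [IsScalarTower A K L] [IsScalarTower A B L]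
  [FiniteDimensional K L]

include K L in
theorem intNorm_eq_minpoly_coeff_zero_pow (s : B) :
    Algebra.intNorm A B s = ((-1) ^ (minpoly A s).natDegree * (minpoly A s).coeff 0) ^
      Module.finrank (IntermediateField.adjoin K {algebraMap B L s}) L := by
  have : IsIntegralClosure B A L := IsIntegralClosure.of_isIntegrallyClosed B A L
  have hs : IsIntegral A s := Algebra.IsIntegral.isIntegral s
  have hsL : IsIntegral K (algebraMap B L s) := Algebra.IsIntegral.isIntegral _
  apply IsFractionRing.injective A K
  rw [Algebra.algebraMap_intNorm (L := L), Algebra.norm_eq_norm_adjoin]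
  have h1 := Algebra.PowerBasis.norm_gen_eq_coeff_zero_minpoly
    (IntermediateField.adjoin.powerBasis hsL)
  rw [IntermediateField.adjoin.powerBasis_gen, IntermediateField.minpoly_gen,
    IntermediateField.adjoin.powerBasis_dim] at h1
  rw [h1, minpoly.isIntegrallyClosed_eq_field_fractions K L hs]
  rw [(minpoly.monic hs).natDegree_map]
  simp

omit [IsIntegrallyClosed B] [Module.IsTorsionFree A B] [IsFractionRing B L] in
theorem natDegree_minpoly_mul_finrank_adjoin (s : B) :
    (minpoly A s).natDegree * Module.finrank (IntermediateField.adjoin K {algebraMap B L s}) L =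
      Module.finrank K L := by
  have hs : IsIntegral A s := Algebra.IsIntegral.isIntegral s
  have hsL : IsIntegral K (algebraMap B L s) := Algebra.IsIntegral.isIntegral _
  rw [← Module.finrank_mul_finrank K (IntermediateField.adjoin K {algebraMap B L s}) L,
    IntermediateField.adjoin.finrank hsL, minpoly.isIntegrallyClosed_eq_field_fractions K L hs,
    (minpoly.monic hs).natDegree_map]

omit [IsDomain A] [IsIntegrallyClosed A] [IsDomain B] [IsIntegrallyClosed B]
  [Algebra.IsIntegral A B] [Module.IsTorsionFree A B] in
theorem even_finrank_adjoin (τ : B ≃ₐ[A] B) (hτ : ∀ b, τ (τ b) = b) (hτ' : ∃ b, τ b ≠ b) (s : B)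
    (hs : τ s = s) :
    Even (Module.finrank (IntermediateField.adjoin K {algebraMap B L s}) L) := by
  let σ : Gal(L/K) := IsFractionRing.fieldEquivOfAlgEquiv K L L τ
  have hσ (b : B) : σ (algebraMap B L b) = algebraMap B L (τ b) :=
    IsFractionRing.fieldEquivOfAlgEquiv_algebraMap K L L τ b
  have hσ2 : orderOf σ = 2 := by
    apply orderOf_eq_prime
    · ext x
      obtain ⟨a, b, -, rfl⟩ := IsFractionRing.div_surjective (A := B) x
      simp [pow_two, hσ, hτ]
    · intro h
      obtain ⟨b, hb⟩ := hτ'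
      apply hb
      apply IsFractionRing.injective B L
      rw [← hσ, h, AlgEquiv.one_apply]
  have hcard : Module.finrank (IntermediateField.fixedField (Subgroup.zpowers σ)) L = 2 := by
    rw [IntermediateField.finrank_fixedField_eq_card, Nat.card_zpowers, hσ2]
  have hle : IntermediateField.adjoin K {algebraMap B L s} ≤
      IntermediateField.fixedField (Subgroup.zpowers σ) := by
    rw [IntermediateField.adjoin_simple_le_iff, IntermediateField.mem_fixedField_iff]
    intro f hf
    obtain ⟨k, rfl⟩ := Subgroup.mem_zpowers_iff.1 hf
    have : (σ ^ k) ∈ MulAction.stabilizer Gal(L/K) (algebraMap B L s) :=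
      Subgroup.zpow_mem _ (by rw [MulAction.mem_stabilizer_iff, AlgEquiv.smul_def, hσ, hs]) k
    exact this
  let : Algebra (IntermediateField.adjoin K {algebraMap B L s})
    (IntermediateField.fixedField (Subgroup.zpowers σ)) :=
    (IntermediateField.inclusion hle).toAlgebra
  have : IsScalarTower (IntermediateField.adjoin K {algebraMap B L s})
    (IntermediateField.fixedField (Subgroup.zpowers σ)) L := IsScalarTower.of_algebraMap_eq' rfl
  rw [← Module.finrank_mul_finrank _ (IntermediateField.fixedField (Subgroup.zpowers σ)) L, hcard]
  exact even_two.mul_left _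

theorem minpoly_comp_neg_X {A B : Type*} [CommRing A] [IsDomain A] [IsIntegrallyClosed A]
    [CommRing B] [IsDomain B] [Algebra A B] [Algebra.IsIntegral A B] [Module.IsTorsionFree A B]
    (τ : B ≃ₐ[A] B) (s : B) (hs : τ s = -s) :
    (minpoly A s).comp (-X) = (-1) ^ (minpoly A s).natDegree * minpoly A s := by
  have hs' : IsIntegral A s := Algebra.IsIntegral.isIntegral s
  have h1 : minpoly A (-s) = minpoly A s := by rw [← hs, minpoly.algEquiv_eq]
  have h0 : aeval (-s) (minpoly A s) = 0 := by rw [← h1, minpoly.aeval]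
  have h2 : (-1) ^ (minpoly A s).natDegree * (minpoly A s).comp (-X) = minpoly A s := by
    apply minpoly.IsIntegrallyClosed.unique_of_degree_le_degree_minpoly
    · exact (minpoly.monic hs').neg_one_pow_natDegree_mul_comp_neg_X
    · simp [aeval_comp, h0]
    · rcases neg_one_pow_eq_or A[X] (minpoly A s).natDegree with h | h <;> simp [h, degree_neg]
  nth_rewrite 3 [← h2]
  rw [← mul_assoc, ← mul_pow]
  simp
end Norm

section RealPolynomials

theorem eval_pos_of_monic_of_no_root {g : ℝ[X]} (hg : g.Monic) (h : ∀ x : ℝ, g.eval x ≠ 0)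
    (x : ℝ) : 0 < g.eval x := by
  by_contra! hx
  have hd : 0 < g.degree := by
    rw [← natDegree_pos_iff_degree_pos]
    by_contra! h0
    have := (Monic.natDegree_eq_zero hg).1 (by omega)
    simp [this] at hx
    linarith
  have ht := Polynomial.tendsto_atTop_of_leadingCoeff_nonneg g hd (by simp [hg.leadingCoeff])
  obtain ⟨y, hy, hxy⟩ := ((ht.eventually_ge_atTop 0).and (Filter.eventually_ge_atTop x)).exists
  obtain ⟨z, -, hz⟩ := intermediate_value_Icc hxy g.continuous.continuousOn ⟨hx, hy⟩
  exact h z hz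

theorem neg_one_pow_card_pos_roots_mul_eval_zero_pos {p : ℝ[X]} (hp : p.Monic)
    (h0 : p.eval 0 ≠ 0) :
    0 < (-1) ^ (p.roots.filter (0 < ·)).card * p.eval 0 := by
  obtain ⟨g, hg, -, hgr⟩ := exists_prod_multiset_X_sub_C_mul p
  have hmon : g.Monic := (monic_multisetProd_X_sub_C p.roots).of_mul_monic_left (by rwa [hg])
  have hpos := eval_pos_of_monic_of_no_root hmon (fun x hx => by
    have : x ∈ g.roots := (mem_roots hmon.ne_zero).2 hx
    simp [hgr] at this) 0
  have key (s : Multiset ℝ) (hs : (0 : ℝ) ∉ s) :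
      0 < (-1) ^ (s.filter (0 < ·)).card * (s.map fun a => X - C a).prod.eval 0 := by
    induction s using Multiset.induction_on with
    | empty => simp
    | cons a s ih =>
      simp only [Multiset.mem_cons, not_or] at hs
      have := ih hs.2
      rcases lt_or_gt_of_ne hs.1 with h | h
      · rw [Multiset.filter_cons_of_pos _ h]
        simp only [Multiset.card_cons, Multiset.map_cons, Multiset.prod_cons, eval_mul, eval_sub,
          eval_X, eval_C, pow_succ]
        nlinarith [mul_pos h this]
      · rw [Multiset.filter_cons_of_neg _ (by linarith)]
        simp only [Multiset.map_cons, Multiset.prod_cons, eval_mul, eval_sub,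
          eval_X, eval_C]
        nlinarith [mul_pos (neg_pos.2 h) this]
  have h1 := key p.roots (fun h => h0 (isRoot_of_mem_roots h))
  nth_rewrite 2 [← hg]
  rw [eval_mul, ← mul_assoc]
  exact mul_pos h1 hpos

theorem even_natDegree_of_comp_neg_X {p : ℝ[X]} (hp0 : p.eval 0 ≠ 0)
    (hp : p.comp (-X) = (-1) ^ p.natDegree * p) : Even p.natDegree := by
  have := congrArg (eval 0) hp
  simp only [eval_comp, eval_neg, eval_X, neg_zero, eval_mul, eval_pow, eval_one] at this
  by_contra h
  rw [Nat.not_even_iff_odd] at h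
  rw [h.neg_one_pow] at this
  apply hp0
  linarith

theorem sign_eval_zero_of_nodup {p : ℝ[X]} (hm : p.Monic) (hp0 : p.eval 0 ≠ 0)
    (hp : p.comp (-X) = (-1) ^ p.natDegree * p) (hnd : p.roots.Nodup) :
    ∃ k, p.roots.toFinset.card = 2 * k ∧ 0 < (-1) ^ k * p.eval 0 := by
  have he := even_natDegree_of_comp_neg_X hp0 hp
  rw [he.neg_one_pow, one_mul] at hp
  have hneg (x : ℝ) : p.eval (-x) = p.eval x := by
    nth_rewrite 2 [← hp]
    simp
  refine ⟨(p.roots.filter (0 < ·)).card, ?_, neg_one_pow_card_pos_roots_mul_eval_zero_pos hm hp0⟩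
  have h1 : (p.roots.filter (0 < ·)).card = (p.roots.toFinset.filter (0 < ·)).card := by
    rw [← Multiset.toFinset_filter, Multiset.toFinset_card_of_nodup (hnd.filter _)]
  have h2 : (p.roots.toFinset.filter (¬ 0 < ·)).card = (p.roots.toFinset.filter (0 < ·)).card := by
    have hmem (x : ℝ) : x ∈ p.roots.toFinset ↔ p.eval x = 0 := by simp [hm.ne_zero]
    refine Finset.card_bij' (fun x _ => -x) (fun x _ => -x) ?_ ?_ (by simp) (by simp)
    · intro x hx
      simp only [Finset.mem_filter, hmem, hneg] at hx ⊢
      refine ⟨hx.1, ?_⟩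
      rcases lt_trichotomy x 0 with h | h | h
      · linarith
      · exact absurd (h ▸ hx.1) hp0
      · exact absurd h hx.2
    · intro x hx
      simp only [Finset.mem_filter, hmem, hneg] at hx ⊢
      exact ⟨hx.1, by linarith⟩
  rw [h1, ← Finset.card_filter_add_card_filter_not (s := p.roots.toFinset) (fun x => 0 < x), h2]
  ring

theorem sign_eval_zero_of_no_imaginary_root {p : ℝ[X]} (hm : p.Monic)
    (hp : p.comp (-X) = (-1) ^ p.natDegree * p)
    (him : ∀ z : ℂ, aeval z p = 0 → z.re ≠ 0) :
    ∃ k, p.natDegree = 2 * k ∧ 0 < (-1) ^ k * p.eval 0 := by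
  have hp0 : p.eval 0 ≠ 0 := by
    intro h
    apply him 0 _ rfl
    rw [← map_zero (algebraMap ℝ ℂ), aeval_algebraMap_apply, coe_aeval_eq_eval, h, map_zero]
  have he := even_natDegree_of_comp_neg_X hp0 hp
  obtain ⟨k, hk⟩ := he
  refine ⟨k, by omega, ?_⟩
  have hp' : p.comp (-X) = p := by rw [hp, Even.neg_one_pow ⟨k, hk⟩, one_mul]
  have hq : expand ℝ 2 (contract 2 p) = p := by
    ext i
    rw [coeff_expand two_pos]
    split_ifs with h
    · rw [coeff_contract two_ne_zero, Nat.div_mul_cancel h]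
    · have h1 := congrArg (coeff · i) hp'
      have hX : (-X : ℝ[X]) = C (-1) * X := by simp
      simp only [hX, comp_C_mul_X_coeff] at h1
      have : Odd i := by rwa [← Nat.not_even_iff_odd, even_iff_two_dvd]
      rw [this.neg_one_pow] at h1
      linarith
  set q := contract 2 p with hqdef
  have hqm : q.Monic := by
    rw [← hq] at hm
    exact (monic_expand_iff two_pos).1 hm
  have hqd : q.natDegree = k := by
    have := natDegree_expand 2 q
    rw [hq] at this
    omega
  have h1 : ((-1) ^ q.natDegree * q.comp (-X)).Monic := hqm.neg_one_pow_natDegree_mul_comp_neg_X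
  have h1e (x : ℝ) : ((-1) ^ q.natDegree * q.comp (-X)).eval x = (-1) ^ k * q.eval (-x) := by
    simp [hqd]
  have hp0q : p.eval 0 = q.eval 0 := by rw [← hq]; simp
  have h2 := neg_one_pow_card_pos_roots_mul_eval_zero_pos h1 (by simp [hqd, ← hp0q, hp0])
  rw [Multiset.filter_eq_nil.2, Multiset.card_zero, pow_zero, one_mul, h1e, neg_zero,
    ← hp0q] at h2
  · exact h2
  · intro x hx hx0
    rw [mem_roots h1.ne_zero, IsRoot.def, h1e] at hx
    have hx' : q.eval (-x) = 0 := by simpa using hx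
    apply him (Complex.I * (√x : ℝ))
    · rw [← hq, expand_aeval]
      have : (Complex.I * ((√x : ℝ) : ℂ)) ^ 2 = algebraMap ℝ ℂ (-x) := by
        rw [mul_pow, Complex.I_sq, ← Complex.ofReal_pow, Real.sq_sqrt hx0.le]
        simp
      rw [this, aeval_algebraMap_apply, coe_aeval_eq_eval, hx', map_zero]
    · simp

end RealPolynomials

theorem Submodule.exists_mem_forall_apply_ne_zero {V W : Type*} [AddCommGroup V] [Module ℝ V]
    [AddCommGroup W] [Module ℝ W] (P : Submodule ℝ V) {F : Set (V →ₗ[ℝ] W)} (hF : F.Finite)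
    (h : ∀ l ∈ F, ∃ s ∈ P, l s ≠ 0) : ∃ s ∈ P, ∀ l ∈ F, l s ≠ 0 := by
  classical
  let T : Finset (Subspace ℝ P) := hF.toFinset.image fun l => LinearMap.ker (l.comp P.subtype)
  have hT : (⊤ : Subspace ℝ P) ∉ T := by
    intro hmem
    obtain ⟨l, hl, hk⟩ := Finset.mem_image.1 hmem
    obtain ⟨s, hs, hls⟩ := h l (hF.mem_toFinset.1 hl)
    have : (⟨s, hs⟩ : P) ∈ LinearMap.ker (l.comp P.subtype) := by rw [hk]; trivial
    exact hls this
  obtain ⟨s, hs⟩ := (Set.ne_univ_iff_exists_notMem _).1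
    (Subspace.biUnion_ne_univ_of_top_notMem hT)
  refine ⟨s, s.2, fun l hl h0 => hs ?_⟩
  exact Set.mem_iUnion₂.2 ⟨_, Finset.mem_image.2 ⟨l, hF.mem_toFinset.2 hl, rfl⟩, h0⟩

section Involution

variable {B : Type*} [CommRing B] [Algebra ℝ B] (τ : B ≃ₐ[ℝ] B)

/-- The elements negated by `τ`. -/
def antiInvariants : Submodule ℝ B := LinearMap.ker (τ.toLinearMap + LinearMap.id)

/-- The elements fixed by `τ`. -/
def invariants : Submodule ℝ B := LinearMap.ker (τ.toLinearMap - LinearMap.id)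

variable {τ}

theorem mem_antiInvariants {s : B} : s ∈ antiInvariants τ ↔ τ s = -s := by
  simp [antiInvariants, add_eq_zero_iff_eq_neg]

theorem mem_invariants {s : B} : s ∈ invariants τ ↔ τ s = s := by
  simp [invariants, sub_eq_zero]

theorem ext_of_eq_on_invariants_antiInvariants (hτ : ∀ b, τ (τ b) = b) {x y : B →ₐ[ℝ] ℂ}
    (h1 : ∀ s ∈ invariants τ, x s = y s) (h2 : ∀ s ∈ antiInvariants τ, x s = y s) : x = y := by
  ext b
  have e1 := h1 (b + τ b) (by rw [mem_invariants, map_add, hτ, add_comm])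
  have e2 := h2 (b - τ b) (by rw [mem_antiInvariants, map_sub, hτ]; ring)
  rw [map_add, map_add] at e1
  rw [map_sub, map_sub] at e2
  linear_combination (e1 + e2) / 2

theorem exists_antiInvariant_apply_ne_zero (hτ : ∀ b, τ (τ b) = b) {x : B →ₐ[ℝ] ℂ}
    (hx : x.comp (τ : B →ₐ[ℝ] B) ≠ x) : ∃ s ∈ antiInvariants τ, x s ≠ 0 := by
  obtain ⟨b, hb⟩ := DFunLike.ne_iff.1 hx
  refine ⟨τ b - b, by rw [mem_antiInvariants, map_sub, hτ]; ring, ?_⟩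
  rw [map_sub, sub_ne_zero]
  exact hb

theorem exists_antiInvariant_apply_ne (hτ : ∀ b, τ (τ b) = b) {x y : B →ₐ[ℝ] ℂ}
    (hx : x.comp (τ : B →ₐ[ℝ] B) ≠ x) (hxy : x ≠ y) : ∃ s ∈ antiInvariants τ, x s ≠ y s := by
  by_contra! h
  obtain ⟨s, hs, hs0⟩ := exists_antiInvariant_apply_ne_zero hτ hx
  refine hxy (ext_of_eq_on_invariants_antiInvariants hτ (fun v hv => ?_) h)
  have h1 := h (s * v) (by
    rw [mem_antiInvariants] at hs ⊢
    rw [mem_invariants] at hv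
    rw [map_mul, hs, hv, neg_mul])
  rw [map_mul, map_mul, ← h s hs] at h1
  exact mul_left_cancel₀ hs0 h1

theorem exists_invariant_apply_ne (hτ : ∀ b, τ (τ b) = b) {x y : B →ₐ[ℝ] ℂ}
    (hxy : x ≠ y) (hxy' : x.comp (τ : B →ₐ[ℝ] B) ≠ y) : ∃ s ∈ invariants τ, x s ≠ y s := by
  by_contra! h
  have hmul (s t : B) (hs : s ∈ antiInvariants τ) (ht : t ∈ antiInvariants τ) :
      x s * x t = y s * y t := by
    rw [← map_mul, ← map_mul]
    apply h
    rw [mem_antiInvariants] at hs ht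
    rw [mem_invariants, map_mul, hs, ht, neg_mul_neg]
  by_cases h0 : ∀ s ∈ antiInvariants τ, x s = 0
  · refine hxy (ext_of_eq_on_invariants_antiInvariants hτ h fun s hs => ?_)
    have := hmul s s hs hs
    rw [h0 s hs, zero_mul, eq_comm, mul_self_eq_zero] at this
    rw [h0 s hs, this]
  · push Not at h0
    obtain ⟨s, hs, hs0⟩ := h0
    rcases mul_self_eq_mul_self_iff.1 (hmul s s hs hs) with h1 | h1
    · refine hxy (ext_of_eq_on_invariants_antiInvariants hτ h fun t ht => ?_)
      have := hmul s t hs ht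
      rw [← h1] at this
      exact mul_left_cancel₀ hs0 this
    · refine hxy' (ext_of_eq_on_invariants_antiInvariants hτ (fun t ht => ?_) fun t ht => ?_)
      · rw [mem_invariants] at ht
        simp [ht, h t (mem_invariants.2 ht)]
      · have := hmul s t hs ht
        rw [mem_antiInvariants] at ht
        have h2 : y s = - x s := by rw [h1, neg_neg]
        rw [h2] at this
        have h3 : x (τ t) = -x t := by rw [ht, map_neg]
        change x (τ t) = y t
        rw [h3]
        apply mul_left_cancel₀ hs0
        linear_combination -this

end Involution

section Fiber

set_option linter.unusedSectionVars false

variable {A B : Type*} [CommRing A] [IsDomain A] [IsIntegrallyClosed A] [CommRing B]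
  [IsDomain B] [Algebra A B] [Module.Finite A B] [Module.IsTorsionFree A B]
  [Algebra ℝ A] [Algebra ℝ B] [IsScalarTower ℝ A B]

variable (B) in
/-- The complex points of `B` over the real point `w` of `A`. -/
def pointFiber (w : A →ₐ[ℝ] ℝ) : Set (B →ₐ[ℝ] ℂ) := {x | ∀ a, x (algebraMap A B a) = (w a : ℂ)}

theorem aeval_minpoly_map_eq_zero_iff (w : A →ₐ[ℝ] ℝ) (s : B) (z : ℂ) :
    aeval z ((minpoly A s).map (w : A →+* ℝ)) = 0 ↔ ∃ x ∈ pointFiber B w, x s = z := by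
  constructor
  · intro h
    obtain ⟨x, hx, hxs⟩ := exists_ringHom_of_isRoot_minpoly (B := B)
      ((algebraMap ℝ ℂ).comp (w : A →+* ℝ)) s z
      (by rwa [aeval_def, ← eval_map, Polynomial.map_map] at h)
    refine ⟨{ x with commutes' := fun r => ?_ }, fun a => RingHom.congr_fun hx a, hxs⟩
    have := RingHom.congr_fun hx (algebraMap ℝ A r)
    change x (algebraMap ℝ B r) = _
    rw [IsScalarTower.algebraMap_apply ℝ A B]
    simpa using this
  · rintro ⟨x, hx, rfl⟩
    have h1 : (algebraMap ℝ ℂ).comp (w : A →+* ℝ) = (x : B →+* ℂ).comp (algebraMap A B) :=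
      RingHom.ext fun a => (hx a).symm
    rw [aeval_def, ← eval_map, Polynomial.map_map, h1, ← Polynomial.map_map, eval_map]
    have h2 := minpoly.aeval A s
    rw [aeval_def, ← eval_map] at h2
    have h3 := congrArg (x : B →+* ℂ) h2
    rw [← eval_map_apply, map_zero] at h3
    rw [← eval_map]
    exact h3

theorem minpoly_map_monic (w : A →ₐ[ℝ] ℝ) (s : B) :
    ((minpoly A s).map (w : A →+* ℝ)).Monic :=
  (minpoly.monic (Algebra.IsIntegral.isIntegral s)).map _

theorem natDegree_minpoly_map (w : A →ₐ[ℝ] ℝ) (s : B) :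
    ((minpoly A s).map (w : A →+* ℝ)).natDegree = (minpoly A s).natDegree :=
  (minpoly.monic (Algebra.IsIntegral.isIntegral s)).natDegree_map _

theorem pointFiber_finite (w : A →ₐ[ℝ] ℝ) : (pointFiber B w).Finite := by
  obtain ⟨G, hG⟩ := (Module.Finite.fg_top : (⊤ : Submodule A B).FG)
  let f : (B →ₐ[ℝ] ℂ) → (G → ℂ) := fun x g => x g
  refine Set.Finite.of_finite_image (f := f) ?_ ?_
  · refine (Set.Finite.pi (t := fun g : G =>
      {z : ℂ | aeval z ((minpoly A (g : B)).map (w : A →+* ℝ)) = 0}) fun g => ?_).subset ?_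
    · have h := (minpoly_map_monic w (g : B)).map (algebraMap ℝ ℂ)
      refine (Multiset.toFinset (((minpoly A (g : B)).map (w : A →+* ℝ)).map
        (algebraMap ℝ ℂ)).roots).finite_toSet.subset fun z hz => ?_
      rw [Finset.mem_coe, Multiset.mem_toFinset, mem_roots h.ne_zero, IsRoot.def, eval_map]
      exact hz
    · rintro _ ⟨x, hx, rfl⟩ g -
      exact (aeval_minpoly_map_eq_zero_iff w _ _).2 ⟨x, hx, rfl⟩
  · intro x hx y hy hxy
    ext b
    have hb : b ∈ Submodule.span A (G : Set B) := by rw [hG]; trivial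
    induction hb using Submodule.span_induction with
    | mem b hb => exact congrFun hxy ⟨b, hb⟩
    | zero => simp
    | add a b _ _ ha hb => rw [map_add, map_add, ha, hb]
    | smul a b _ hb => rw [Algebra.smul_def, map_mul, map_mul, hx a, hy a, hb]

/-- The complex conjugate of a point. -/
noncomputable def conjPoint (x : B →ₐ[ℝ] ℂ) : B →ₐ[ℝ] ℂ := (Complex.conjAe : ℂ →ₐ[ℝ] ℂ).comp x

theorem conjPoint_mem {w : A →ₐ[ℝ] ℝ} {x : B →ₐ[ℝ] ℂ} (hx : x ∈ pointFiber B w) :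
    conjPoint x ∈ pointFiber B w := fun a => by
  simp [conjPoint, hx a]

theorem comp_mem_pointFiber (τ : B ≃ₐ[A] B) {w : A →ₐ[ℝ] ℝ} {x : B →ₐ[ℝ] ℂ}
    (hx : x ∈ pointFiber B w) :
    x.comp ((τ.restrictScalars ℝ : B ≃ₐ[ℝ] B) : B →ₐ[ℝ] B) ∈ pointFiber B w := fun a => by
  simp [hx a]

end Fiber

section Sign

set_option linter.unusedSectionVars false

variable {A B : Type*} (K L : Type*) [CommRing A] [IsDomain A] [IsIntegrallyClosed A] [CommRing B]
  [IsDomain B] [IsIntegrallyClosed B] [Algebra A B] [Module.Finite A B]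
  [Module.IsTorsionFree A B] [Field K] [Field L] [Algebra A K] [IsFractionRing A K] [Algebra B L]
  [IsFractionRing B L] [Algebra A L] [Algebra K L] [IsScalarTower A K L] [IsScalarTower A B L]
  [FiniteDimensional K L] [Algebra ℝ A] [Algebra ℝ B] [IsScalarTower ℝ A B]
  (τ : B ≃ₐ[A] B)

/-- No point of the fiber over `w` is fixed by `τ`. -/
def FreeFiber (w : A →ₐ[ℝ] ℝ) : Prop :=
  ∀ x ∈ pointFiber B w, x.comp ((τ.restrictScalars ℝ : B ≃ₐ[ℝ] B) : B →ₐ[ℝ] B) ≠ x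

variable {τ}

theorem aeval_zero_real (p : ℝ[X]) : aeval (0 : ℂ) p = (p.eval 0 : ℝ) := by
  rw [← map_zero (algebraMap ℝ ℂ), aeval_algebraMap_apply, coe_aeval_eq_eval]
  rfl

include K L in
theorem map_intNorm_eq (w : A →ₐ[ℝ] ℝ) (s : B) :
    w (Algebra.intNorm A B s) = ((-1) ^ (minpoly A s).natDegree *
      ((minpoly A s).map (w : A →+* ℝ)).eval 0) ^
      Module.finrank (IntermediateField.adjoin K {algebraMap B L s}) L := by
  rw [intNorm_eq_minpoly_coeff_zero_pow K L, ← coeff_zero_eq_eval_zero, coeff_map]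
  simp

include K L in
theorem map_intNorm_ne_zero_iff (w : A →ₐ[ℝ] ℝ) (s : B) :
    w (Algebra.intNorm A B s) ≠ 0 ↔ ∀ x ∈ pointFiber B w, x s ≠ 0 := by
  have h := aeval_minpoly_map_eq_zero_iff w s 0
  have h2 : (∀ x ∈ pointFiber B w, x s ≠ 0) ↔ ((minpoly A s).map (w : A →+* ℝ)).eval 0 ≠ 0 := by
    rw [aeval_zero_real, Complex.ofReal_eq_zero] at h
    rw [Ne, h]
    push Not
    rfl
  rw [h2, map_intNorm_eq K L]
  have : Module.finrank (IntermediateField.adjoin K {algebraMap B L s}) L ≠ 0 :=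
    Module.finrank_pos.ne'
  rw [Ne, pow_eq_zero_iff this]
  simp

include K L in
theorem map_intNorm_mul_pos (hτ : ∀ b, τ (τ b) = b) (hτ' : ∃ b, τ b ≠ b) {w : A →ₐ[ℝ] ℝ}
    {s s' : B} (hs : τ s = -s) (hs' : τ s' = -s') (h : ∀ x ∈ pointFiber B w, x s ≠ 0)
    (h' : ∀ x ∈ pointFiber B w, x s' ≠ 0) :
    0 < w (Algebra.intNorm A B s) * w (Algebra.intNorm A B s') := by
  have hss : τ (s * s') = s * s' := by rw [map_mul, hs, hs', neg_mul_neg]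
  have h1 := (map_intNorm_ne_zero_iff K L w (s * s')).2
    (fun x hx => by rw [map_mul]; exact mul_ne_zero (h x hx) (h' x hx))
  have h2 := map_intNorm_eq K L w (s * s')
  rw [← map_mul, ← map_mul]
  refine lt_of_le_of_ne ?_ h1.symm
  rw [h2]
  exact (even_finrank_adjoin K L τ hτ hτ' _ hss).pow_nonneg _

theorem FreeFiber.exists_antiInvariant (hτ : ∀ b, τ (τ b) = b) {w : A →ₐ[ℝ] ℝ}
    (hw : FreeFiber τ w) : ∃ s, τ s = -s ∧ ∀ x ∈ pointFiber B w, x s ≠ 0 := by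
  obtain ⟨s, hs, h⟩ := (antiInvariants (τ.restrictScalars ℝ)).exists_mem_forall_apply_ne_zero
    ((pointFiber_finite (B := B) w).image fun x => x.toLinearMap) (by
      rintro _ ⟨x, hx, rfl⟩
      exact exists_antiInvariant_apply_ne_zero hτ (hw x hx))
  exact ⟨s, mem_antiInvariants.1 hs, fun x hx => h _ ⟨x, hx, rfl⟩⟩

variable (τ) in
/-- Norms of anti-invariant elements have the same sign at `w` and at `w'`. -/
def SameSign (w w' : A →ₐ[ℝ] ℝ) : Prop :=
  ∀ s s' : B, τ s = -s → τ s' = -s' → (∀ x ∈ pointFiber B w, x s ≠ 0) →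
    (∀ x ∈ pointFiber B w', x s' ≠ 0) →
    0 < w (Algebra.intNorm A B s) * w' (Algebra.intNorm A B s')

theorem SameSign.symm {w w' : A →ₐ[ℝ] ℝ} (h : SameSign τ w w') : SameSign τ w' w :=
  fun s s' hs hs' h1 h2 => by rw [mul_comm]; exact h s' s hs' hs h2 h1

theorem SameSign.trans (hτ : ∀ b, τ (τ b) = b) {w w' w'' : A →ₐ[ℝ] ℝ} (hw' : FreeFiber τ w')
    (h : SameSign τ w w') (h' : SameSign τ w' w'') : SameSign τ w w'' := by
  intro s s'' hs hs'' h1 h3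
  obtain ⟨s', hs', h2⟩ := hw'.exists_antiInvariant hτ
  have e1 := h s s' hs hs' h1 h2
  have e2 := h' s' s'' hs' hs'' h2 h3
  have e3 := mul_pos e1 e2
  have : 0 < w' (Algebra.intNorm A B s') ^ 2 := by
    refine sq_pos_of_ne_zero fun h0 => ?_
    rw [h0] at e1
    simp at e1
  refine pos_of_mul_pos_left (b := w' (Algebra.intNorm A B s') ^ 2) ?_ this.le
  linarith

include K L in
theorem sameSign_of_path (hτ : ∀ b, τ (τ b) = b) (hτ' : ∃ b, τ b ≠ b)
    (γ : ℝ → (A →ₐ[ℝ] ℝ)) (hγ : ∀ a, Continuous fun t => γ t a)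
    (hfree : ∀ t ∈ Set.Icc (0 : ℝ) 1, FreeFiber τ (γ t)) : SameSign τ (γ 0) (γ 1) := by
  have hconn : IsPreconnected (Set.Icc (0 : ℝ) 1) := isPreconnected_Icc
  -- transitivity only makes sense between free points
  have := hconn.induction₂ (fun t u => t ∈ Set.Icc (0 : ℝ) 1 → u ∈ Set.Icc (0 : ℝ) 1 →
    SameSign τ (γ t) (γ u)) ?_ ?_ ?_ (x := 0) (y := 1) (by simp) (by simp)
  · exact this (by simp) (by simp)
  · intro t ht
    obtain ⟨s, hs, h⟩ := (hfree t ht).exists_antiInvariant hτ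
    have hne := (map_intNorm_ne_zero_iff K L (γ t) s).2 h
    have hcont : Continuous fun u => γ t (Algebra.intNorm A B s) * γ u (Algebra.intNorm A B s) :=
      continuous_const.mul (hγ _)
    have hev := (hcont.tendsto t).eventually (lt_mem_nhds (mul_self_pos.2 hne))
    filter_upwards [nhdsWithin_le_nhds hev] with u hu _ _ s1 s2 hs1 hs2 h1 h2
    have hu0 : γ u (Algebra.intNorm A B s) ≠ 0 := fun h0 => by simp [h0] at hu
    have e1 := map_intNorm_mul_pos K L hτ hτ' hs1 hs h1 h
    have e2 := map_intNorm_mul_pos K L hτ hτ' hs2 hs h2 ((map_intNorm_ne_zero_iff K L _ _).1 hu0)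
    have e3 := mul_pos (mul_pos e1 e2) hu
    refine pos_of_mul_pos_left (b := (γ t (Algebra.intNorm A B s) *
      γ u (Algebra.intNorm A B s)) ^ 2) ?_ (by positivity)
    linarith
  · intro t u v _ hu _ h1 h2 ht hv
    exact (h1 ht hu).trans hτ (hfree u hu) (h2 hu hv)
  · intro t u _ _ h hu ht
    exact (h ht hu).symm

end Sign

section Count

set_option linter.unusedSectionVars false

variable {A B : Type*} (K L : Type*) [CommRing A] [IsDomain A] [IsIntegrallyClosed A] [CommRing B]
  [IsDomain B] [IsIntegrallyClosed B] [Algebra A B] [Module.Finite A B]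
  [Module.IsTorsionFree A B] [Field K] [Field L] [Algebra A K] [IsFractionRing A K] [Algebra B L]
  [IsFractionRing B L] [Algebra A L] [Algebra K L] [IsScalarTower A K L] [IsScalarTower A B L]
  [FiniteDimensional K L] [Algebra ℝ A] [Algebra ℝ B] [IsScalarTower ℝ A B]
  {τ : B ≃ₐ[A] B}

theorem ncard_image_pointFiber_eq (w : A →ₐ[ℝ] ℝ) (s : B) :
    ((fun x : B →ₐ[ℝ] ℂ => x s) '' pointFiber B w).ncard =
      (((minpoly A s).map (w : A →+* ℝ)).map (algebraMap ℝ ℂ)).roots.toFinset.card := by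
  rw [← Set.ncard_coe_finset]
  congr 1
  ext z
  have h := (minpoly_map_monic w s).map (algebraMap ℝ ℂ)
  rw [Finset.mem_coe, Multiset.mem_toFinset, mem_roots h.ne_zero, IsRoot.def, eval_map,
    ← aeval_def, aeval_minpoly_map_eq_zero_iff]
  rfl

theorem ncard_image_pointFiber_le (w : A →ₐ[ℝ] ℝ) (s : B) :
    ((fun x : B →ₐ[ℝ] ℂ => x s) '' pointFiber B w).ncard ≤ (minpoly A s).natDegree := by
  rw [ncard_image_pointFiber_eq, ← natDegree_minpoly_map w s,
    ← natDegree_map_eq_of_injective (algebraMap ℝ ℂ).injective]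
  exact (Multiset.toFinset_card_le _).trans (card_roots' _)

include K L in
theorem freeFiber_of_finrank_le (hτ : ∀ b, τ (τ b) = b) (hτ' : ∃ b, τ b ≠ b) {w : A →ₐ[ℝ] ℝ}
    (hw : Module.finrank K L ≤ (pointFiber B w).ncard) : FreeFiber τ w := by
  classical
  intro x₀ hx₀ hfix
  set τ' : B ≃ₐ[ℝ] B := τ.restrictScalars ℝ
  obtain ⟨v, hv, hsep⟩ := (invariants τ').exists_mem_forall_apply_ne_zero
    (F := (fun p : (B →ₐ[ℝ] ℂ) × (B →ₐ[ℝ] ℂ) => p.1.toLinearMap - p.2.toLinearMap) ''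
      {p ∈ pointFiber B w ×ˢ pointFiber B w | p.1 ≠ p.2 ∧ p.1.comp (τ' : B →ₐ[ℝ] B) ≠ p.2})
    ((((pointFiber_finite w).prod (pointFiber_finite w)).subset (Set.sep_subset _ _)).image _)
    (by
      rintro _ ⟨⟨x, y⟩, ⟨-, h1, h2⟩, rfl⟩
      obtain ⟨s, hs, h⟩ := exists_invariant_apply_ne hτ h1 h2
      exact ⟨s, hs, sub_ne_zero.2 h⟩)
  have hsep' (x y : B →ₐ[ℝ] ℂ) (hx : x ∈ pointFiber B w) (hy : y ∈ pointFiber B w)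
      (hxy : x v = y v) : x = y ∨ x.comp (τ' : B →ₐ[ℝ] B) = y := by
    by_contra! h
    exact hsep _ ⟨(x, y), ⟨⟨hx, hy⟩, h⟩, rfl⟩ (sub_eq_zero.2 hxy)
  set F := (pointFiber_finite (B := B) w).toFinset with hF
  have hmem (x) : x ∈ F ↔ x ∈ pointFiber B w := Set.Finite.mem_toFinset _
  have hFcard : F.card = (pointFiber B w).ncard := (Set.ncard_eq_toFinset_card _ _).symm
  have himg : (F.image fun x => x v).card ≤ (minpoly A v).natDegree := by
    rw [← Set.ncard_coe_finset, Finset.coe_image, hF, Set.Finite.coe_toFinset]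
    exact ncard_image_pointFiber_le w v
  have h1 : (F.erase x₀).card ≤ 2 * ((F.erase x₀).image fun x => x v).card := by
    refine Finset.card_le_mul_card_image _ _ fun z hz => ?_
    obtain ⟨x, hx, rfl⟩ := Finset.mem_image.1 hz
    refine (Finset.card_le_card (t := {x, x.comp (τ' : B →ₐ[ℝ] B)}) fun y hy => ?_).trans
      Finset.card_le_two
    simp only [Finset.mem_filter, Finset.mem_erase, hmem] at hx hy
    rcases hsep' x y hx.2 hy.1.2 hy.2.symm with h | h <;> simp [h]
  have h2 : ((F.erase x₀).image fun x => x v).card < (F.image fun x => x v).card := by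
    refine Finset.card_lt_card ⟨Finset.image_subset_image (Finset.erase_subset _ _), fun h => ?_⟩
    obtain ⟨y, hy, hyx⟩ := Finset.mem_image.1
      (h (Finset.mem_image_of_mem (fun x : B →ₐ[ℝ] ℂ => x v) ((hmem _).2 hx₀)))
    rw [Finset.mem_erase, hmem] at hy
    rcases hsep' x₀ y hx₀ hy.2 hyx.symm with h | h
    · exact hy.1 h.symm
    · exact hy.1 (h.symm.trans hfix)
  have h3 := natDegree_minpoly_mul_finrank_adjoin (A := A) K L v
  have h4 := even_finrank_adjoin K L τ hτ hτ' v (mem_invariants.1 hv)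
  have h5 : 0 < Module.finrank (IntermediateField.adjoin K {algebraMap B L v}) L :=
    Module.finrank_pos
  have h6 : 2 ≤ Module.finrank (IntermediateField.adjoin K {algebraMap B L v}) L := by
    obtain ⟨k, hk⟩ := h4
    omega
  have h7 := Finset.card_erase_add_one ((hmem x₀).2 hx₀)
  have h8 := Nat.mul_le_mul_left (minpoly A v).natDegree h6
  omega

include K L in
theorem exists_sign_of_finrank_le (hτ : ∀ b, τ (τ b) = b) (hτ' : ∃ b, τ b ≠ b) {w : A →ₐ[ℝ] ℝ}
    (hw : Module.finrank K L ≤ (pointFiber B w).ncard) :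
    Module.finrank K L = (pointFiber B w).ncard ∧
    ∃ s, τ s = -s ∧ (∀ x ∈ pointFiber B w, x s ≠ 0) ∧
      ∃ k, {x ∈ pointFiber B w | conjPoint x = x}.ncard = 2 * k ∧
        0 < (-1) ^ k * w (Algebra.intNorm A B s) := by
  classical
  have hfree := freeFiber_of_finrank_le K L hτ hτ' hw
  set τ' : B ≃ₐ[ℝ] B := τ.restrictScalars ℝ
  obtain ⟨s, hs, hsep⟩ := (antiInvariants τ').exists_mem_forall_apply_ne_zero
    (F := (fun p : (B →ₐ[ℝ] ℂ) × (B →ₐ[ℝ] ℂ) => p.1.toLinearMap - p.2.toLinearMap) ''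
      {p ∈ pointFiber B w ×ˢ pointFiber B w | p.1 ≠ p.2})
    ((((pointFiber_finite w).prod (pointFiber_finite w)).subset (Set.sep_subset _ _)).image _)
    (by
      rintro _ ⟨⟨x, y⟩, ⟨⟨hx, -⟩, h1⟩, rfl⟩
      obtain ⟨s, hs, h⟩ := exists_antiInvariant_apply_ne hτ (hfree x hx) h1
      exact ⟨s, hs, sub_ne_zero.2 h⟩)
  have hinj : Set.InjOn (fun x : B →ₐ[ℝ] ℂ => x s) (pointFiber B w) := by
    intro x hx y hy hxy
    by_contra h
    exact hsep _ ⟨(x, y), ⟨⟨hx, hy⟩, h⟩, rfl⟩ (sub_eq_zero.2 hxy)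
  rw [mem_antiInvariants] at hs
  have hne (x) (hx : x ∈ pointFiber B w) : x s ≠ 0 := by
    intro h0
    refine hfree x hx (hinj (comp_mem_pointFiber τ hx) hx ?_)
    change x (τ' s) = x s
    rw [hs, map_neg, h0, neg_zero]
  set p := (minpoly A s).map (w : A →+* ℝ) with hp
  have hpm : p.Monic := minpoly_map_monic w s
  have hpd : p.natDegree = (minpoly A s).natDegree := natDegree_minpoly_map w s
  have h1 := natDegree_minpoly_mul_finrank_adjoin (A := A) K L s
  have h5 : 0 < Module.finrank (IntermediateField.adjoin K {algebraMap B L s}) L :=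
    Module.finrank_pos
  have h2 := ncard_image_pointFiber_eq w s
  rw [hinj.ncard_image] at h2
  have h3 : (pointFiber B w).ncard ≤ (minpoly A s).natDegree := by
    rw [← hinj.ncard_image]
    exact ncard_image_pointFiber_le w s
  have h4 := Nat.le_mul_of_pos_right (minpoly A s).natDegree h5
  have hfr : Module.finrank K L = (pointFiber B w).ncard := by omega
  have hd : (minpoly A s).natDegree = (pointFiber B w).ncard := by omega
  have hd0 : 0 < (minpoly A s).natDegree :=
    minpoly.natDegree_pos (Algebra.IsIntegral.isIntegral s)
  have he : Module.finrank (IntermediateField.adjoin K {algebraMap B L s}) L = 1 := by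
    rw [hfr, ← hd] at h1
    exact Nat.eq_of_mul_eq_mul_left hd0 (by rw [h1, mul_one])
  refine ⟨hfr, s, hs, hne, ?_⟩
  have hp0 : p.eval 0 ≠ 0 := by
    intro h
    have h' : aeval (0 : ℂ) p = 0 := by rw [aeval_zero_real, h, Complex.ofReal_zero]
    obtain ⟨x, hx, hx0⟩ := (aeval_minpoly_map_eq_zero_iff w s 0).1 h'
    exact hne x hx hx0
  have hpc : p.comp (-X) = (-1) ^ p.natDegree * p := by
    have := congrArg (Polynomial.map (w : A →+* ℝ)) (minpoly_comp_neg_X τ s hs)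
    rw [hpd]
    simpa [Polynomial.map_comp] using this
  have hnd' : (p.map (algebraMap ℝ ℂ)).roots.Nodup := by
    rw [← Multiset.toFinset_card_eq_card_iff_nodup]
    apply le_antisymm (Multiset.toFinset_card_le _)
    rw [← h2, ← hd, ← hpd, ← natDegree_map_eq_of_injective (algebraMap ℝ ℂ).injective]
    exact card_roots' _
  have hnd : p.roots.Nodup := by
    have := Multiset.nodup_of_le
      (map_roots_le_of_injective p (algebraMap ℝ ℂ).injective) hnd'
    exact Multiset.Nodup.of_map _ this
  obtain ⟨k, hk, hpos⟩ := sign_eval_zero_of_nodup hpm hp0 hpc hnd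
  have hev := even_natDegree_of_comp_neg_X hp0 hpc
  refine ⟨k, ?_, ?_⟩
  · rw [← hk, ← Set.ncard_coe_finset]
    refine Set.ncard_congr (fun x _ => (x s).re) ?_ ?_ ?_
    · rintro x ⟨hx, hxc⟩
      rw [Finset.mem_coe, Multiset.mem_toFinset, mem_roots hpm.ne_zero, IsRoot.def]
      have h6 : ((x s).re : ℂ) = x s := Complex.conj_eq_iff_re.1 (DFunLike.congr_fun hxc s)
      have h7 := (aeval_minpoly_map_eq_zero_iff w s (x s)).2 ⟨x, hx, rfl⟩
      rw [← h6] at h7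
      change aeval (algebraMap ℝ ℂ _) p = 0 at h7
      rw [aeval_algebraMap_apply, coe_aeval_eq_eval] at h7
      exact Complex.ofReal_eq_zero.1 h7
    · rintro x y ⟨hx, hxc⟩ ⟨hy, hyc⟩ hxy
      apply hinj hx hy
      have h6 : ((x s).re : ℂ) = x s := Complex.conj_eq_iff_re.1 (DFunLike.congr_fun hxc s)
      have h7 : ((y s).re : ℂ) = y s := Complex.conj_eq_iff_re.1 (DFunLike.congr_fun hyc s)
      change x s = y s
      rw [← h6, ← h7]
      exact congrArg _ hxy
    · intro r hr
      rw [Finset.mem_coe, Multiset.mem_toFinset, mem_roots hpm.ne_zero, IsRoot.def] at hr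
      have h7 : aeval (algebraMap ℝ ℂ r) p = 0 := by
        rw [aeval_algebraMap_apply, coe_aeval_eq_eval, hr, map_zero]
      obtain ⟨x, hx, hxr⟩ := (aeval_minpoly_map_eq_zero_iff w s _).1 h7
      refine ⟨x, ⟨hx, hinj (conjPoint_mem hx) hx ?_⟩, by simp [hxr]⟩
      change (starRingEnd ℂ) (x s) = x s
      rw [hxr]
      exact Complex.conj_ofReal r
  · rw [map_intNorm_eq K L, he, pow_one, ← hpd, hev.neg_one_pow, one_mul]
    exact hpos

include K L in
theorem exists_sign_of_no_conj_swap (hτ : ∀ b, τ (τ b) = b) {w : A →ₐ[ℝ] ℝ}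
    (hfree : FreeFiber τ w) (hconj : ∀ x ∈ pointFiber B w,
      conjPoint (x.comp ((τ.restrictScalars ℝ : B ≃ₐ[ℝ] B) : B →ₐ[ℝ] B)) ≠ x) :
    ∃ s, τ s = -s ∧ (∀ x ∈ pointFiber B w, x s ≠ 0) ∧
      ∃ k, Module.finrank K L = 2 * k ∧ 0 < (-1) ^ k * w (Algebra.intNorm A B s) := by
  classical
  set τ' : B ≃ₐ[ℝ] B := τ.restrictScalars ℝ
  obtain ⟨s, hs, hsep⟩ := (antiInvariants τ').exists_mem_forall_apply_ne_zero
    (F := (fun x : (B →ₐ[ℝ] ℂ) => x.toLinearMap -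
      (conjPoint (x.comp (τ' : B →ₐ[ℝ] B))).toLinearMap) '' pointFiber B w)
    ((pointFiber_finite w).image _)
    (by
      rintro _ ⟨x, hx, rfl⟩
      obtain ⟨s, hs, h⟩ := exists_antiInvariant_apply_ne hτ (hfree x hx) (hconj x hx).symm
      exact ⟨s, hs, sub_ne_zero.2 h⟩)
  rw [mem_antiInvariants] at hs
  have hre (x) (hx : x ∈ pointFiber B w) : (x s).re ≠ 0 := by
    intro h0
    refine hsep _ ⟨x, hx, rfl⟩ (sub_eq_zero.2 ?_)
    change x s = (starRingEnd ℂ) (x (τ' s))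
    rw [hs, map_neg, map_neg]
    apply Complex.ext <;> simp [h0]
  set p := (minpoly A s).map (w : A →+* ℝ) with hp
  have hpm : p.Monic := minpoly_map_monic w s
  have hpd : p.natDegree = (minpoly A s).natDegree := natDegree_minpoly_map w s
  have h1 := natDegree_minpoly_mul_finrank_adjoin (A := A) K L s
  have hpc : p.comp (-X) = (-1) ^ p.natDegree * p := by
    have := congrArg (Polynomial.map (w : A →+* ℝ)) (minpoly_comp_neg_X τ s hs)
    rw [hpd]
    simpa [Polynomial.map_comp] using this
  obtain ⟨k, hk, hpos⟩ := sign_eval_zero_of_no_imaginary_root hpm hpc (fun z hz => by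
    obtain ⟨x, hx, rfl⟩ := (aeval_minpoly_map_eq_zero_iff w s z).1 hz
    exact hre x hx)
  refine ⟨s, hs, fun x hx h0 => hre x hx (by simp [h0]),
    k * Module.finrank (IntermediateField.adjoin K {algebraMap B L s}) L, ?_, ?_⟩
  · rw [← h1, ← hpd, hk, mul_assoc]
  · rw [map_intNorm_eq K L, ← hpd, hk, pow_mul (-1 : ℝ) k, ← mul_pow,
      Even.neg_one_pow (even_two_mul k), one_mul]
    exact pow_pos hpos _

include K L in
theorem ncard_conjPoint_fixed_modEq (hτ : ∀ b, τ (τ b) = b) (hτ' : ∃ b, τ b ≠ b)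
    {w w₀ : A →ₐ[ℝ] ℝ} (hw : Module.finrank K L ≤ (pointFiber B w).ncard)
    (hfree : FreeFiber τ w₀) (hconj : ∀ x ∈ pointFiber B w₀,
      conjPoint (x.comp ((τ.restrictScalars ℝ : B ≃ₐ[ℝ] B) : B →ₐ[ℝ] B)) ≠ x)
    (hsign : SameSign τ w w₀) :
    {x ∈ pointFiber B w | conjPoint x = x}.ncard ≡ (pointFiber B w).ncard [MOD 4] := by
  obtain ⟨hfr, s, hs, h1, k, hk, hkpos⟩ := exists_sign_of_finrank_le K L hτ hτ' hw
  obtain ⟨s₀, hs₀, h2, l, hl, hlpos⟩ := exists_sign_of_no_conj_swap K L hτ hfree hconj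
  have h := hsign s s₀ hs hs₀ h1 h2
  rw [hk, ← hfr, hl]
  have h3 := mul_pos hkpos hlpos
  have h4 : 0 < (-1 : ℝ) ^ (k + l) := by
    refine pos_of_mul_pos_left (b := w (Algebra.intNorm A B s) * w₀ (Algebra.intNorm A B s₀))
      ?_ h.le
    rw [pow_add]
    linarith
  have h5 : Even (k + l) := by
    by_contra ho
    rw [Nat.not_even_iff_odd] at ho
    rw [ho.neg_one_pow] at h4
    linarith
  obtain ⟨j, hj⟩ := h5
  unfold Nat.ModEq
  omega

end Count

section LatticeCount

variable {σ : Type*} [Fintype σ] [DecidableEq σ]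

/-- The exponent vectors of weighted degree at most `d`. -/
def boundedExponents (h : σ → ℕ) (d : ℕ) : Finset (σ → ℕ) :=
  {e ∈ Fintype.piFinset fun _ => Finset.range (d + 1) | ∑ i, h i * e i ≤ d}

theorem mem_boundedExponents {h : σ → ℕ} (hh : ∀ i, 0 < h i) {d : ℕ} {e : σ → ℕ} :
    e ∈ boundedExponents h d ↔ ∑ i, h i * e i ≤ d := by
  simp only [boundedExponents, Finset.mem_filter, Fintype.mem_piFinset, Finset.mem_range,
    and_iff_right_iff_imp, Nat.lt_succ_iff]
  intro H i
  calc e i ≤ h i * e i := Nat.le_mul_of_pos_left _ (hh i)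
    _ ≤ ∑ i, h i * e i :=
      Finset.single_le_sum (f := fun i => h i * e i) (fun _ _ => Nat.zero_le _) (Finset.mem_univ i)
    _ ≤ d := H

theorem card_boundedExponents_le (h : σ → ℕ) (d : ℕ) :
    (boundedExponents h d).card ≤ (d + 1) ^ Fintype.card σ := by
  refine (Finset.card_filter_le _ _).trans ?_
  simp

theorem card_boundedExponents_one_le {h : σ → ℕ} (hh : ∀ i, 0 < h i) (d : ℕ) :
    (boundedExponents (fun _ : σ => 1) d).card ≤ (∏ i, h i) * (boundedExponents h d).card := by
  have : (∏ i, h i) * (boundedExponents h d).card =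
      ((Fintype.piFinset fun i => Finset.range (h i)) ×ˢ boundedExponents h d).card := by
    simp
  rw [this]
  refine Finset.card_le_card_of_injOn (fun u => (fun i => u i % h i, fun i => u i / h i)) ?_ ?_
  · intro u hu
    simp only [Finset.mem_coe, mem_boundedExponents (fun _ => one_pos), one_mul] at hu
    simp only [Finset.coe_product, Set.mem_prod, Finset.mem_coe, Fintype.mem_piFinset,
      Finset.mem_range, mem_boundedExponents hh]
    exact ⟨fun i => Nat.mod_lt _ (hh i),
      (Finset.sum_le_sum fun i _ => Nat.mul_div_le (u i) (h i)).trans hu⟩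
  · intro u _ v _ huv
    simp only [Prod.mk.injEq] at huv
    funext i
    rw [← Nat.mod_add_div (u i) (h i), ← Nat.mod_add_div (v i) (h i), congrFun huv.1 i,
      congrFun huv.2 i]

theorem mul_card_boundedExponents_le {h : σ → ℕ} (hh : ∀ i, 0 < h i) (d : ℕ) :
    (∏ i, h i) * (boundedExponents h d).card ≤
      (boundedExponents (fun _ : σ => 1) (d + ∑ i, h i)).card := by
  have : (∏ i, h i) * (boundedExponents h d).card =
      ((Fintype.piFinset fun i => Finset.range (h i)) ×ˢ boundedExponents h d).card := by
    simp
  rw [this]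
  refine Finset.card_le_card_of_injOn (fun p i => p.1 i + h i * p.2 i) ?_ ?_
  · rintro ⟨r, e⟩ hp
    simp only [Finset.coe_product, Set.mem_prod, Finset.mem_coe, Fintype.mem_piFinset,
      Finset.mem_range, mem_boundedExponents hh] at hp
    simp only [Finset.mem_coe, mem_boundedExponents (fun _ => one_pos), one_mul,
      Finset.sum_add_distrib]
    have := Finset.sum_le_sum (s := Finset.univ) fun i _ => (hp.1 i).le
    omega
  · rintro ⟨r, e⟩ hp ⟨r', e'⟩ hp' hpp
    simp only [Finset.coe_product, Set.mem_prod, Finset.mem_coe, Fintype.mem_piFinset,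
      Finset.mem_range] at hp hp'
    have h1 (i : σ) : r i = r' i := by
      have := congrArg (· % h i) (congrFun hpp i)
      simpa [Nat.mod_eq_of_lt (hp.1 i), Nat.mod_eq_of_lt (hp'.1 i)] using this
    have h2 (i : σ) : e i = e' i := by
      have := congrFun hpp i
      simp only [h1, Nat.add_left_cancel_iff] at this
      exact Nat.eq_of_mul_eq_mul_left (hh i) this
    rw [Prod.mk.injEq]
    exact ⟨funext h1, funext h2⟩

theorem le_of_mul_card_boundedExponents_one_le (P Q E : ℕ)
    (H : ∀ d, Q * (boundedExponents (fun _ : σ => 1) d).card ≤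
      P * (boundedExponents (fun _ : σ => 1) (d + E)).card) : Q ≤ P := by
  by_contra! hPQ
  set c : ℕ → ℕ := fun d => (boundedExponents (fun _ : σ => 1) d).card with hc
  have hc0 : 1 ≤ c 0 := Finset.card_pos.2 ⟨0, by simp [mem_boundedExponents]⟩
  have hind (j : ℕ) : Q ^ j ≤ P ^ j * c (j * E) := by
    induction j with
    | zero => simpa using hc0
    | succ j ih =>
      calc Q ^ (j + 1) = Q ^ j * Q := pow_succ _ _
        _ ≤ (P ^ j * c (j * E)) * Q := Nat.mul_le_mul_right _ ih
        _ = P ^ j * (Q * c (j * E)) := by ring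
        _ ≤ P ^ j * (P * c (j * E + E)) := Nat.mul_le_mul_left _ (H _)
        _ = P ^ (j + 1) * c ((j + 1) * E) := by rw [pow_succ, Nat.succ_mul]; ring
  have hP : 0 < P := by
    rcases Nat.eq_zero_or_pos P with rfl | h
    · have := hind 1
      simp only [pow_one, zero_mul] at this
      omega
    · exact h
  have hbound (j : ℕ) : ((Q : ℝ) / P) ^ j ≤ ((E + 1 : ℕ) : ℝ) ^ Fintype.card σ *
      ((j : ℝ) + 1) ^ Fintype.card σ := by
    rw [div_pow, div_le_iff₀ (by positivity), ← mul_pow]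
    have h1 : c (j * E) ≤ ((E + 1) * (j + 1)) ^ Fintype.card σ :=
      (card_boundedExponents_le _ _).trans (Nat.pow_le_pow_left (by nlinarith) _)
    have h2 := (hind j).trans (Nat.mul_le_mul_left _ h1)
    rw [mul_comm]
    exact_mod_cast h2
  have hr : 1 < (Q : ℝ) / P := by
    rw [one_lt_div (by positivity)]
    exact_mod_cast hPQ
  have ht := (tendsto_pow_const_div_const_pow_of_one_lt (Fintype.card σ) hr).comp
    (Filter.tendsto_add_atTop_nat 1)
  have ht2 := ht.const_mul (((E + 1 : ℕ) : ℝ) ^ Fintype.card σ * ((Q : ℝ) / P))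
  rw [mul_zero] at ht2
  obtain ⟨j, hj⟩ := (ht2.eventually (gt_mem_nhds one_pos)).exists
  have h3 := hbound j
  simp only [Function.comp_apply, Nat.cast_add, Nat.cast_one] at hj
  have hq : 0 < ((Q : ℝ) / P) ^ j := by positivity
  rw [pow_succ ((Q : ℝ) / P) j] at hj
  have hq1 : ((Q : ℝ) / P) ≠ 0 := by positivity
  generalize (Q : ℝ) / P = r at hj h3 hq hq1
  have e : ((E : ℝ) + 1) ^ Fintype.card σ * r *
      (((j : ℝ) + 1) ^ Fintype.card σ / (r ^ j * r)) =
      ((E : ℝ) + 1) ^ Fintype.card σ * ((j : ℝ) + 1) ^ Fintype.card σ / r ^ j := by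
    field_simp
  rw [e, div_lt_one hq] at hj
  push_cast at h3
  linarith

end LatticeCount

section GradedFinite

open MvPolynomial

variable {σ ι : Type} [Fintype σ] [Fintype ι]

omit [Fintype σ] in
theorem weightedHomogeneousComponent_mul_of_left {h : σ → ℕ} {k : ℕ} {φ : MvPolynomial σ ℝ}
    (hφ : IsWeightedHomogeneous h φ k) (ψ : MvPolynomial σ ℝ) (n : ℕ) :
    weightedHomogeneousComponent h n (φ * ψ) =
      if k ≤ n then φ * weightedHomogeneousComponent h (n - k) ψ else 0 := by
  let _ := weightedGradedAlgebra ℝ h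
  have := DirectSum.coe_decompose_mul_of_left_mem (𝒜 := weightedHomogeneousSubmodule ℝ h)
    (a := φ) (b := ψ) (i := k) n hφ
  rw [← weightedDecomposition.decompose'_apply, ← weightedDecomposition.decompose'_apply]
  exact this

omit [Fintype ι] in
theorem exists_pow_X_mem_span {W : ι → MvPolynomial σ ℝ}
    (hzero : ∀ x : σ → ℂ, (∀ i, MvPolynomial.aeval x (W i) = 0) → x = 0) :
    ∃ e : ℕ, ∀ j, (X j : MvPolynomial σ ℝ) ^ e ∈ Ideal.span (Set.range W) := by
  have h (j : σ) : ∃ e : ℕ, (X j : MvPolynomial σ ℝ) ^ e ∈ Ideal.span (Set.range W) := by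
    rw [← Ideal.mem_radical_iff, ← vanishingIdeal_zeroLocus_eq_radical (K := ℂ),
      mem_vanishingIdeal_iff]
    intro x hx
    rw [zeroLocus_span] at hx
    have : x = 0 := hzero x fun i => hx _ ⟨i, rfl⟩
    simp [this]
  choose e he using h
  refine ⟨∑ j, e j, fun j => ?_⟩
  obtain ⟨c, hc⟩ := Nat.exists_eq_add_of_le
    (Finset.single_le_sum (fun _ _ => Nat.zero_le _) (Finset.mem_univ j) : e j ≤ ∑ j, e j)
  rw [hc, pow_add]
  exact Ideal.mul_mem_right _ _ (he j)

theorem module_finite_of_weightedHomogeneous [Algebra (MvPolynomial ι ℝ) (MvPolynomial σ ℝ)]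
    {W : ι → MvPolynomial σ ℝ}
    (halg : ∀ a, algebraMap (MvPolynomial ι ℝ) (MvPolynomial σ ℝ) a = MvPolynomial.aeval W a)
    {h : σ → ℕ} {k : ι → ℕ} (hk : ∀ i, 0 < k i)
    (hW : ∀ i, IsWeightedHomogeneous h (W i) (k i))
    (hzero : ∀ x : σ → ℂ, (∀ i, MvPolynomial.aeval x (W i) = 0) → x = 0) :
    Module.Finite (MvPolynomial ι ℝ) (MvPolynomial σ ℝ) := by
  classical
  obtain ⟨e, he⟩ := exists_pow_X_mem_span hzero
  have hIsT : IsScalarTower ℝ (MvPolynomial ι ℝ) (MvPolynomial σ ℝ) :=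
    IsScalarTower.of_algebraMap_eq fun r => by
      rw [halg, algebraMap_eq, algebraMap_eq, MvPolynomial.algHom_C]
      rfl
  set G : Set (MvPolynomial σ ℝ) := {p | ∃ d : σ →₀ ℕ, (∀ j, d j < e) ∧ p =
      MvPolynomial.monomial d 1}
  have hG : G.Finite := by
    have : {d : σ →₀ ℕ | ∀ j, d j < e}.Finite := by
      refine (Set.finite_Iic (Finsupp.equivFunOnFinite.symm fun _ => e)).subset fun d hd j => ?_
      exact (hd j).le
    refine (this.image fun d => (MvPolynomial.monomial d 1 : MvPolynomial σ ℝ)).subset ?_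
    rintro _ ⟨d, hd, rfl⟩
    exact ⟨d, hd, rfl⟩
  set P := Submodule.span (MvPolynomial ι ℝ) G with hP
  have hC (r : ℝ) (p : MvPolynomial σ ℝ) (hp : p ∈ P) : MvPolynomial.C r * p ∈ P := by
    have := P.smul_mem (algebraMap ℝ (MvPolynomial ι ℝ) r) hp
    rwa [algebraMap_smul, MvPolynomial.smul_eq_C_mul] at this
  have hWmul (i : ι) (p : MvPolynomial σ ℝ) (hp : p ∈ P) : W i * p ∈ P := by
    have := P.smul_mem (X i) hp
    rwa [Algebra.smul_def, halg, MvPolynomial.aeval_X] at this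
  have hhom (n : ℕ) (hmon : ∀ d : σ →₀ ℕ, Finsupp.weight h d = n → MvPolynomial.monomial d 1 ∈ P)
      (p : MvPolynomial σ ℝ) (hp : IsWeightedHomogeneous h p n) : p ∈ P := by
    rw [p.as_sum]
    refine P.sum_mem fun d hd => ?_
    have := hC (MvPolynomial.coeff d p) _ (hmon d (hp (mem_support_iff.1 hd)))
    rwa [MvPolynomial.C_mul_monomial, mul_one] at this
  have hmon (n : ℕ) : ∀ d : σ →₀ ℕ, Finsupp.weight h d = n → MvPolynomial.monomial d 1 ∈ P := by
    induction n using Nat.strong_induction_on with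
    | _ n ih =>
      intro d hd
      by_cases hde : ∀ j, d j < e
      · exact Submodule.subset_span ⟨d, hde, rfl⟩
      · push Not at hde
        obtain ⟨j, hj⟩ := hde
        have hmem : (MvPolynomial.monomial d 1 : MvPolynomial σ ℝ) ∈ Ideal.span (Set.range W) := by
          have : (MvPolynomial.monomial d 1 : MvPolynomial σ ℝ) =
              X j ^ e * MvPolynomial.monomial (d - Finsupp.single j e) 1 := by
            rw [MvPolynomial.X_pow_eq_monomial, MvPolynomial.monomial_mul, one_mul,
                add_tsub_cancel_of_le]
            rwa [Finsupp.single_le_iff]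
          rw [this]
          exact Ideal.mul_mem_right _ _ (he j)
        obtain ⟨g, hg⟩ := (Ideal.mem_span_range_iff_exists_fun).1 hmem
        have hself : weightedHomogeneousComponent h n (MvPolynomial.monomial d 1 :
            MvPolynomial σ ℝ) =
            MvPolynomial.monomial d 1 :=
          (isWeightedHomogeneous_monomial h d 1 hd).weightedHomogeneousComponent_same
        rw [← hself, ← hg, map_sum]
        refine P.sum_mem fun i _ => ?_
        rw [mul_comm, weightedHomogeneousComponent_mul_of_left (hW i)]
        split_ifs with hki
        · exact hWmul i _ (hhom _ (ih _ (by have := hk i; omega)) _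
            (weightedHomogeneousComponent_isWeightedHomogeneous _ _))
        · exact P.zero_mem
  refine ⟨⟨hG.toFinset, ?_⟩⟩
  rw [Set.Finite.coe_toFinset, eq_top_iff]
  intro p _
  rw [p.as_sum]
  refine P.sum_mem fun d _ => ?_
  have := hC (MvPolynomial.coeff d p) _ (hmon _ d rfl)
  rwa [MvPolynomial.C_mul_monomial, mul_one] at this

theorem aeval_injective_of_module_finite [Algebra (MvPolynomial ι ℝ) (MvPolynomial σ ℝ)]
    {W : ι → MvPolynomial σ ℝ}
    (halg : ∀ a, algebraMap (MvPolynomial ι ℝ) (MvPolynomial σ ℝ) a = MvPolynomial.aeval W a)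
    [Module.Finite (MvPolynomial ι ℝ) (MvPolynomial σ ℝ)]
    (hcard : Fintype.card ι = Fintype.card σ) :
    Function.Injective (algebraMap (MvPolynomial ι ℝ) (MvPolynomial σ ℝ)) := by
  have hint : Algebra.IsIntegral (Algebra.adjoin ℝ (Set.range W)) (MvPolynomial σ ℝ) := by
    refine ⟨fun b => ?_⟩
    have hb : IsIntegral (MvPolynomial ι ℝ) b := Algebra.IsIntegral.isIntegral b
    have hmem (a : MvPolynomial ι ℝ) : algebraMap _ (MvPolynomial σ ℝ) a ∈
        Algebra.adjoin ℝ (Set.range W) := by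
      rw [halg, Algebra.adjoin_range_eq_range_aeval]
      exact ⟨a, rfl⟩
    obtain ⟨p, hp, hpb⟩ := hb
    refine ⟨p.map ((algebraMap (MvPolynomial ι ℝ) (MvPolynomial σ ℝ)).codRestrict _ hmem),
      hp.map _, ?_⟩
    rw [Polynomial.eval₂_map]
    exact hpb
  have hle : Cardinal.mk ι ≤ Algebra.trdeg ℝ (MvPolynomial σ ℝ) := by
    rw [MvPolynomial.trdeg_of_isDomain, Cardinal.mk_fintype, Cardinal.mk_fintype, hcard,
      Cardinal.lift_natCast]
  have := (Algebra.IsAlgebraic.isTranscendenceBasis_of_le_trdeg_of_finite ℝ W hle).1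
  intro a b hab
  rw [halg, halg] at hab
  exact this hab

end GradedFinite

section Rank

open MvPolynomial

variable {σ ι : Type} [Fintype σ] [Fintype ι]

theorem card_boundedExponents_one_congr [DecidableEq σ] [DecidableEq ι] (e : ι ≃ σ) (d : ℕ) :
    (boundedExponents (fun _ : ι => 1) d).card = (boundedExponents (fun _ : σ => 1) d).card := by
  refine Finset.card_bij' (fun u _ => u ∘ e.symm) (fun u _ => u ∘ e) ?_ ?_ ?_ ?_
  · intro u hu
    rw [mem_boundedExponents fun _ => one_pos] at hu ⊢
    rw [← Equiv.sum_comp e]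
    simpa using hu
  · intro u hu
    rw [mem_boundedExponents fun _ => one_pos] at hu ⊢
    rw [← Equiv.sum_comp e.symm]
    simpa using hu
  · intro u _
    ext; simp
  · intro u _
    ext; simp

theorem finrank_mul_prod_le [Algebra (MvPolynomial ι ℝ) (MvPolynomial σ ℝ)]
    {W : ι → MvPolynomial σ ℝ}
    (halg : ∀ a, algebraMap (MvPolynomial ι ℝ) (MvPolynomial σ ℝ) a = MvPolynomial.aeval W a)
    {h : σ → ℕ} {k : ι → ℕ} (hh : ∀ i, 0 < h i) (hk : ∀ i, 0 < k i)
    (hW : ∀ i, IsWeightedHomogeneous h (W i) (k i)) (hcard : Fintype.card ι = Fintype.card σ) :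
    Module.finrank (MvPolynomial ι ℝ) (MvPolynomial σ ℝ) * ∏ i, h i ≤ ∏ i, k i := by
  classical
  have hIsT : IsScalarTower ℝ (MvPolynomial ι ℝ) (MvPolynomial σ ℝ) :=
    IsScalarTower.of_algebraMap_eq fun r => by
      rw [halg, algebraMap_eq, algebraMap_eq, MvPolynomial.algHom_C]
      rfl
  set n := Module.finrank (MvPolynomial ι ℝ) (MvPolynomial σ ℝ)
  obtain ⟨b, hb⟩ := exists_linearIndependent_of_le_finrank (R := MvPolynomial ι ℝ)
    (M := MvPolynomial σ ℝ) (le_refl n)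
  set D := ∑ j, ∑ c ∈ (b j).support, Finsupp.weight h c with hD
  have hbD (j : Fin n) (c) (hc : c ∈ (b j).support) : Finsupp.weight h c ≤ D :=
    (Finset.single_le_sum (f := fun c => Finsupp.weight h c) (fun _ _ => Nat.zero_le _) hc).trans
      (Finset.single_le_sum (f := fun j => ∑ c ∈ (b j).support, Finsupp.weight h c)
        (fun _ _ => Nat.zero_le _) (Finset.mem_univ j))
  have key (d : ℕ) : n * (boundedExponents k d).card ≤ (boundedExponents h (d + D)).card := by
    have hli : LinearIndependent ℝ fun u : boundedExponents k d =>
        (MvPolynomial.monomial (Finsupp.equivFunOnFinite.symm (u : ι → ℕ)) 1 :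
            MvPolynomial ι ℝ) := by
      have := (basisMonomials ι ℝ).linearIndependent.comp
        (fun u : boundedExponents k d => Finsupp.equivFunOnFinite.symm (u : ι → ℕ))
        (Finsupp.equivFunOnFinite.symm.injective.comp Subtype.val_injective)
      simpa [Function.comp_def] using this
    let T : Finset (MvPolynomial σ ℝ) := (boundedExponents h (d + D)).image fun e =>
      MvPolynomial.monomial (Finsupp.equivFunOnFinite.symm e) 1
    have h1 := linearIndependent_le_span' _ (linearIndependent_smul hli hb)
      (T : Set (MvPolynomial σ ℝ)) (by
      rintro _ ⟨⟨⟨u, hu⟩, j⟩, rfl⟩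
      rw [mem_boundedExponents hk] at hu
      have hhom : IsWeightedHomogeneous h
          (MvPolynomial.aeval W (MvPolynomial.monomial (Finsupp.equivFunOnFinite.symm u) (1 :
              ℝ))) (∑ i, k i * u i) := by
        rw [MvPolynomial.aeval_monomial, map_one, one_mul, Finsupp.prod_fintype _ _ (fun _ =>
            pow_zero _)]
        have := IsWeightedHomogeneous.prod Finset.univ (fun i => W i ^ u i) _ (w := h)
          (fun i _ => (hW i).pow (u i))
        simpa [mul_comm] using this
      simp only [Algebra.smul_def, halg]
      rw [SetLike.mem_coe, MvPolynomial.as_sum (MvPolynomial.aeval W _ * b j)]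
      refine Submodule.sum_mem _ fun c hc => ?_
      obtain ⟨c1, hc1, c2, hc2, rfl⟩ := Finset.mem_add.1 (support_mul _ _ hc)
      have hw1 := hhom (mem_support_iff.1 hc1)
      have hw2 := hbD j c2 hc2
      rw [← mul_one (MvPolynomial.coeff _ _), ← smul_eq_mul, ← MvPolynomial.smul_monomial]
      refine Submodule.smul_mem _ _ (Submodule.subset_span ?_)
      refine Finset.mem_coe.2 (Finset.mem_image.2 ⟨⇑(c1 + c2), ?_, by
        rw [Finsupp.equivFunOnFinite_symm_coe]⟩)
      rw [mem_boundedExponents hh]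
      have : ∑ i, h i * (c1 + c2) i = Finsupp.weight h (c1 + c2) := by
        rw [Finsupp.weight_apply, Finsupp.sum_fintype _ _ (fun _ => by simp)]
        simp [mul_comm]
      rw [this, map_add, hw1]
      omega)
    rw [Cardinal.mk_fintype, Nat.cast_le, Fintype.card_prod, Fintype.card_coe,
      Fintype.card_fin] at h1
    rw [mul_comm]
    exact (h1.trans (Fintype.card_coe T).le).trans Finset.card_image_le
  refine le_of_mul_card_boundedExponents_one_le (σ := σ) _ _ (D + ∑ i, h i) fun d => ?_
  have e := Fintype.equivOfCardEq hcard
  calc n * (∏ i, h i) * (boundedExponents (fun _ : σ => 1) d).card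
      = n * (∏ i, h i) * (boundedExponents (fun _ : ι => 1) d).card := by
        rw [card_boundedExponents_one_congr e]
    _ ≤ n * (∏ i, h i) * ((∏ i, k i) * (boundedExponents k d).card) :=
        Nat.mul_le_mul_left _ (card_boundedExponents_one_le hk d)
    _ = (∏ i, k i) * ((∏ i, h i) * (n * (boundedExponents k d).card)) := by ring
    _ ≤ (∏ i, k i) * ((∏ i, h i) * (boundedExponents h (d + D)).card) :=
        Nat.mul_le_mul_left _ (Nat.mul_le_mul_left _ (key d))
    _ ≤ (∏ i, k i) * (boundedExponents (fun _ : σ => 1) (d + D + ∑ i, h i)).card :=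
        Nat.mul_le_mul_left _ (mul_card_boundedExponents_le hh _)
    _ = _ := by rw [add_assoc]

end Rank

section FreePaths

open MvPolynomial

variable {σ ι κ : Type} [Fintype ι] [Fintype κ]

/-- A nonzero polynomial that vanishes at every point of a line through `w₀` and a point of the
image of the map `W` restricted to the vectors that factor through `q`. -/
theorem exists_ne_zero_vanishing_on_cone (W : ι → MvPolynomial σ ℝ) (q : σ → κ)
    (hcard : Fintype.card κ + 1 < Fintype.card ι) (w₀ : ι → ℝ) :
    ∃ G : MvPolynomial ι ℝ, G ≠ 0 ∧ ∀ (w : ι → ℝ) (c : ℝ) (y : κ → ℂ),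
      (∀ k, (w k : ℂ) = w₀ k + c * (MvPolynomial.aeval (y ∘ q) (W k) - w₀ k)) →
          MvPolynomial.eval w G = 0 := by
  set φ : MvPolynomial ι ℝ →ₐ[ℝ] MvPolynomial (Option κ) ℝ :=
    MvPolynomial.aeval fun k => MvPolynomial.C (w₀ k) + X none * (rename (some ∘ q) (W k) -
        MvPolynomial.C (w₀ k)) with hφ
  have hni : ¬ Function.Injective φ := by
    intro hinj
    have : AlgebraicIndependent ℝ
      fun k => MvPolynomial.C (w₀ k) + X none * (rename (some ∘ q) (W k) - MvPolynomial.C (w₀ k))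
          := hinj
    have h := this.cardinalMk_le_trdeg
    rw [MvPolynomial.trdeg_of_isDomain, Cardinal.lift_id, Cardinal.mk_fintype,
      Cardinal.mk_fintype, Nat.cast_le, Fintype.card_option] at h
    omega
  rw [injective_iff_map_eq_zero] at hni
  push Not at hni
  obtain ⟨G, hG, hG0⟩ := hni
  refine ⟨G, hG0, fun w c y h => ?_⟩
  have h1 : (MvPolynomial.aeval (fun o : Option κ => o.elim (c : ℂ) y)) (φ G) = 0 := by rw [hG,
      map_zero]
  have h2 : (MvPolynomial.aeval (fun o : Option κ => o.elim (c : ℂ) y)).comp φ =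
      (MvPolynomial.aeval fun k => (w k : ℂ)) := by
    refine MvPolynomial.algHom_ext fun k => ?_
    have hq : (fun o : Option κ => o.elim (c : ℂ) y) ∘ some ∘ q = y ∘ q := rfl
    simp only [AlgHom.comp_apply, hφ, MvPolynomial.aeval_X, map_add, map_mul, map_sub,
        MvPolynomial.algHom_C, MvPolynomial.aeval_rename,
      hq, h k]
    rfl
  have h3 := AlgHom.congr_fun h2 G
  rw [AlgHom.comp_apply, h1] at h3
  have h4 : (MvPolynomial.aeval fun k => (w k : ℂ)) G = ((MvPolynomial.eval w G : ℝ) : ℂ) := by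
    have := MvPolynomial.aeval_algebraMap_apply (A := ℝ) ℂ w G
    rw [MvPolynomial.aeval_eq_eval] at this
    exact this
  rw [h4] at h3
  exact_mod_cast h3.symm

variable [Algebra (MvPolynomial ι ℝ) (MvPolynomial σ ℝ)]
  [Module.Finite (MvPolynomial ι ℝ) (MvPolynomial σ ℝ)]
  [Module.IsTorsionFree (MvPolynomial ι ℝ) (MvPolynomial σ ℝ)]
  [IsScalarTower ℝ (MvPolynomial ι ℝ) (MvPolynomial σ ℝ)]
  (K L : Type*) [Field K] [Field L] [Algebra (MvPolynomial ι ℝ) K]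
  [IsFractionRing (MvPolynomial ι ℝ) K] [Algebra (MvPolynomial σ ℝ) L]
  [IsFractionRing (MvPolynomial σ ℝ) L] [Algebra (MvPolynomial ι ℝ) L] [Algebra K L]
  [IsScalarTower (MvPolynomial ι ℝ) K L]
  [IsScalarTower (MvPolynomial ι ℝ) (MvPolynomial σ ℝ) L] [FiniteDimensional K L]
  {τ : MvPolynomial σ ℝ ≃ₐ[MvPolynomial ι ℝ] MvPolynomial σ ℝ}

include K L in
theorem sameSign_of_freeFiber {W : ι → MvPolynomial σ ℝ}
    (halg : ∀ a, algebraMap (MvPolynomial ι ℝ) (MvPolynomial σ ℝ) a = MvPolynomial.aeval W a)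
    (hτ : ∀ b, τ (τ b) = b) (hτ' : ∃ b, τ b ≠ b) {s : σ → σ} (hs : ∀ i, τ (X i) = X (s i))
    {q : σ → κ} (hq : ∀ x : σ → ℂ, x ∘ s = x → ∃ y : κ → ℂ, x = y ∘ q)
    (hcard : Fintype.card κ + 1 < Fintype.card ι) {w w₀ : MvPolynomial ι ℝ →ₐ[ℝ] ℝ}
    (hw : FreeFiber τ w) (hw₀ : FreeFiber τ w₀) : SameSign τ w w₀ := by
  obtain ⟨G, hG, hG'⟩ := exists_ne_zero_vanishing_on_cone W q hcard fun k => w (X k)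
  obtain ⟨G₀, hG₀, hG₀'⟩ := exists_ne_zero_vanishing_on_cone W q hcard fun k => w₀ (X k)
  obtain ⟨w₁, hw₁⟩ : ∃ w₁ : ι → ℝ, MvPolynomial.eval w₁ (G * G₀) ≠ 0 := by
    by_contra! h
    exact mul_ne_zero hG hG₀ (MvPolynomial.funext fun x => by rw [h, map_zero])
  rw [map_mul] at hw₁
  -- the segment from a free point to `w₁` consists of free points
  have key (v : MvPolynomial ι ℝ →ₐ[ℝ] ℝ) (hv : FreeFiber τ v) (F : MvPolynomial ι ℝ)
      (hF : MvPolynomial.eval w₁ F ≠ 0) (hF' : ∀ (w : ι → ℝ) (c : ℝ) (y : κ → ℂ),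
        (∀ k, (w k : ℂ) = v (X k) + c * (MvPolynomial.aeval (y ∘ q) (W k) - v (X k))) →
            MvPolynomial.eval w F = 0)
      (t : ℝ) (ht : t ≠ 0) :
      FreeFiber τ (MvPolynomial.aeval fun k => v (X k) + t * (w₁ k - v (X k))) := by
    intro x hx hxτ
    obtain ⟨y, hy⟩ := hq (fun i => x (X i)) (by
      funext i
      have := AlgHom.congr_fun hxτ (X i)
      rw [AlgHom.comp_apply] at this
      rw [← this]
      change x (X (s i)) = x (τ (X i))
      rw [hs])
    have hxa : x = MvPolynomial.aeval (y ∘ q) := by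
      rw [← hy]
      exact (MvPolynomial.aeval_unique x)
    refine hF (hF' w₁ t⁻¹ y fun k => ?_)
    have h1 := hx (X k)
    rw [halg, MvPolynomial.aeval_X, MvPolynomial.aeval_X, hxa] at h1
    rw [h1]
    have : (t : ℂ) ≠ 0 := by exact_mod_cast ht
    push_cast
    field_simp
    ring
  have key' (v : MvPolynomial ι ℝ →ₐ[ℝ] ℝ) (hv : FreeFiber τ v) (F : MvPolynomial ι ℝ)
      (hF : MvPolynomial.eval w₁ F ≠ 0) (hF' : ∀ (w : ι → ℝ) (c : ℝ) (y : κ → ℂ),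
        (∀ k, (w k : ℂ) = v (X k) + c * (MvPolynomial.aeval (y ∘ q) (W k) - v (X k))) →
            MvPolynomial.eval w F = 0) :
      SameSign τ v (MvPolynomial.aeval w₁) := by
    have h0 : (MvPolynomial.aeval fun k => v (X k) + (0 : ℝ) * (w₁ k - v (X k)) :
        MvPolynomial ι ℝ →ₐ[ℝ] ℝ) = v := by
      refine MvPolynomial.algHom_ext fun k => ?_
      simp
    have h1 : (MvPolynomial.aeval fun k => v (X k) + (1 : ℝ) * (w₁ k - v (X k)) :
        MvPolynomial ι ℝ →ₐ[ℝ] ℝ) = MvPolynomial.aeval w₁ := by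
      refine MvPolynomial.algHom_ext fun k => ?_
      simp
    have := sameSign_of_path K L hτ hτ' (fun t => MvPolynomial.aeval fun k =>
        v (X k) + t * (w₁ k - v (X k)))
      (fun a => by
        simp only [MvPolynomial.aeval_eq_eval]
        exact (MvPolynomial.continuous_eval a).comp (by fun_prop)) (fun t _ => by
        by_cases ht : t = 0
        · subst ht
          rwa [h0]
        · exact key v hv F hF hF' t ht)
    simpa only [h0, h1] using this
  have hfree : FreeFiber τ (MvPolynomial.aeval w₁ : MvPolynomial ι ℝ →ₐ[ℝ] ℝ) := by
    have := key w hw G (left_ne_zero_of_mul hw₁) hG' 1 one_ne_zero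
    simpa using this
  exact (key' w hw G (left_ne_zero_of_mul hw₁) hG').trans hτ hfree
    (key' w₀ hw₀ G₀ (right_ne_zero_of_mul hw₁) hG₀').symm

end FreePaths

section WeightedMap

open MvPolynomial

variable {σ ι κ : Type} [Fintype σ] [Fintype ι] [Fintype κ]

/-- Let `W` be a finite weighted homogeneous polynomial map that is invariant under a permutation
`s` of the coordinates, of order two. If a real fiber has the maximal number of complex points and
some other real fiber has no point that is fixed by `s`, or swapped with its conjugate by `s`, then
the number of real points of the first fiber is determined modulo four. -/
theorem ncard_real_fiber_modEq {W : ι → MvPolynomial σ ℝ} {h : σ → ℕ} {k : ι → ℕ}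
    (hh : ∀ i, 0 < h i) (hk : ∀ i, 0 < k i) (hW : ∀ i, IsWeightedHomogeneous h (W i) (k i))
    (hzero : ∀ x : σ → ℂ, (∀ i, MvPolynomial.aeval x (W i) = 0) → x = 0)
    (hcard : Fintype.card ι = Fintype.card σ) {s : σ → σ} (hs : ∀ i, s (s i) = i)
    (hs' : ∃ i, s i ≠ i) (hWs : ∀ i, rename s (W i) = W i) {q : σ → κ}
    (hq : ∀ x : σ → ℂ, x ∘ s = x → ∃ y : κ → ℂ, x = y ∘ q)
    (hcard' : Fintype.card κ + 1 < Fintype.card ι) {N : ℕ} (hN : ∏ i, k i < (N + 1) * ∏ i, h i)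
    {w w₀ : ι → ℝ} (hw : {x : σ → ℂ | ∀ i, MvPolynomial.aeval x (W i) = w i}.ncard = N)
    (hw₀ : ∀ x : σ → ℂ, (∀ i, MvPolynomial.aeval x (W i) = w₀ i) →
      x ∘ s ≠ x ∧ (fun i => (starRingEnd ℂ) (x (s i))) ≠ x) :
    {x : σ → ℂ | (∀ i, MvPolynomial.aeval x (W i) = w i) ∧ ∀ i, (starRingEnd ℂ) (x i) =
        x i}.ncard ≡ N
      [MOD 4] := by
  let _ : Algebra (MvPolynomial ι ℝ) (MvPolynomial σ ℝ) :=
      (MvPolynomial.aeval W).toRingHom.toAlgebra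
  have halg (a) : algebraMap (MvPolynomial ι ℝ) (MvPolynomial σ ℝ) a = MvPolynomial.aeval W a := rfl
  have : IsScalarTower ℝ (MvPolynomial ι ℝ) (MvPolynomial σ ℝ) :=
    IsScalarTower.of_algebraMap_eq fun r => by
      rw [halg, algebraMap_eq, algebraMap_eq, MvPolynomial.algHom_C]
      rfl
  have : Module.Finite (MvPolynomial ι ℝ) (MvPolynomial σ ℝ) :=
    module_finite_of_weightedHomogeneous halg hk hW hzero
  have : Module.IsTorsionFree (MvPolynomial ι ℝ) (MvPolynomial σ ℝ) :=
    Module.isTorsionFree_iff_algebraMap_injective.2 (aeval_injective_of_module_finite halg hcard)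
  let _ := FractionRing.liftAlgebra (MvPolynomial ι ℝ) (FractionRing (MvPolynomial σ ℝ))
  have := FractionRing.isScalarTower_liftAlgebra (MvPolynomial ι ℝ) (FractionRing (MvPolynomial σ
      ℝ))
  have : FiniteDimensional (FractionRing (MvPolynomial ι ℝ)) (FractionRing (MvPolynomial σ ℝ)) :=
    .of_isLocalization (MvPolynomial ι ℝ) (MvPolynomial σ ℝ) (nonZeroDivisors _)
  have hrank : Module.finrank (FractionRing (MvPolynomial ι ℝ)) (FractionRing (MvPolynomial σ ℝ)) ≤
      N := by
    rw [IsFractionRing.finrank_eq (MvPolynomial ι ℝ) (FractionRing (MvPolynomial ι ℝ))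
        (MvPolynomial σ ℝ) (FractionRing (MvPolynomial σ ℝ))]
    have h1 := finrank_mul_prod_le halg hh hk hW hcard
    have h2 := h1.trans_lt hN
    exact Nat.lt_succ_iff.1 (lt_of_mul_lt_mul_right h2 (Nat.zero_le _))
  have hrs (b : MvPolynomial σ ℝ) : rename s (rename s b) = b := by
    rw [rename_rename, show s ∘ s = id from funext hs, rename_id_apply]
  let τ' : MvPolynomial σ ℝ →ₐ[MvPolynomial ι ℝ] MvPolynomial σ ℝ := AlgHom.mk (rename s :
      MvPolynomial σ ℝ →ₐ[ℝ] MvPolynomial σ ℝ).toRingHom fun a => by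
    have : (rename s : MvPolynomial σ ℝ →ₐ[ℝ] MvPolynomial σ ℝ).comp (MvPolynomial.aeval W) =
        MvPolynomial.aeval W :=
      MvPolynomial.algHom_ext fun i => by simp [hWs]
    exact AlgHom.congr_fun this a
  let τ : MvPolynomial σ ℝ ≃ₐ[MvPolynomial ι ℝ] MvPolynomial σ ℝ :=
      AlgEquiv.ofAlgHom τ' τ' (AlgHom.ext hrs) (AlgHom.ext hrs)
  have hτ (b : MvPolynomial σ ℝ) : τ (τ b) = b := hrs b
  have hτX (i : σ) : τ (X i) = X (s i) := rename_X s i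
  have hτ' : ∃ b, τ b ≠ b := by
    obtain ⟨i, hi⟩ := hs'
    exact ⟨X i, fun h => hi (X_injective ((hτX i).symm.trans h))⟩
  have hmem (v : ι → ℝ) (x : σ → ℂ) : (MvPolynomial.aeval x :
      MvPolynomial σ ℝ →ₐ[ℝ] ℂ) ∈ pointFiber (MvPolynomial σ ℝ) (MvPolynomial.aeval v) ↔
      ∀ i, MvPolynomial.aeval x (W i) = v i := by
    constructor
    · intro hx i
      have := hx (X i)
      rwa [halg, MvPolynomial.aeval_X, MvPolynomial.aeval_X] at this
    · intro hx a
      have : ((MvPolynomial.aeval x : MvPolynomial σ ℝ →ₐ[ℝ] ℂ).comp (MvPolynomial.aeval W)) =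
          Complex.ofRealAm.comp (MvPolynomial.aeval v) :=
        MvPolynomial.algHom_ext fun i => by simp [hx]
      exact AlgHom.congr_fun this a
  have hev (x : MvPolynomial σ ℝ →ₐ[ℝ] ℂ) : ∃ y : σ → ℂ, MvPolynomial.aeval y = x := ⟨_,
      (MvPolynomial.aeval_unique x).symm⟩
  have hinj : Function.Injective fun x : σ → ℂ => (MvPolynomial.aeval x :
      MvPolynomial σ ℝ →ₐ[ℝ] ℂ) := by
    intro x y hxy
    funext i
    have := AlgHom.congr_fun hxy (X i)
    simpa using this
  have hcomp (x : σ → ℂ) : (MvPolynomial.aeval x : MvPolynomial σ ℝ →ₐ[ℝ] ℂ).comp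
      ((τ.restrictScalars ℝ : MvPolynomial σ ℝ ≃ₐ[ℝ] MvPolynomial σ ℝ) :
          MvPolynomial σ ℝ →ₐ[ℝ] MvPolynomial σ ℝ) = MvPolynomial.aeval (x ∘ s) := by
    refine MvPolynomial.algHom_ext fun i => ?_
    rw [MvPolynomial.aeval_X]
    change MvPolynomial.aeval x (τ (X i)) = _
    rw [hτX, MvPolynomial.aeval_X]
    rfl
  have hconj (x : σ → ℂ) : conjPoint (MvPolynomial.aeval x : MvPolynomial σ ℝ →ₐ[ℝ] ℂ) =
      MvPolynomial.aeval fun i => (starRingEnd ℂ) (x i) := by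
    refine MvPolynomial.algHom_ext fun i => ?_
    simp [conjPoint]
  have hset (v : ι → ℝ) : pointFiber (MvPolynomial σ ℝ) (MvPolynomial.aeval v :
      MvPolynomial ι ℝ →ₐ[ℝ] ℝ) =
      (fun x : σ → ℂ => (MvPolynomial.aeval x : MvPolynomial σ ℝ →ₐ[ℝ] ℂ)) '' {x | ∀ i,
          MvPolynomial.aeval x (W i) = v i} := by
    ext x
    obtain ⟨y, rfl⟩ := hev x
    rw [hmem, hinj.mem_set_image]
    rfl
  have hset' : {x ∈ pointFiber (MvPolynomial σ ℝ) (MvPolynomial.aeval w :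
      MvPolynomial ι ℝ →ₐ[ℝ] ℝ) | conjPoint x = x} =
      (fun x : σ → ℂ => (MvPolynomial.aeval x : MvPolynomial σ ℝ →ₐ[ℝ] ℂ)) ''
        {x : σ → ℂ | (∀ i, MvPolynomial.aeval x (W i) = w i) ∧ ∀ i, (starRingEnd ℂ) (x i) =
            x i} := by
    ext x
    obtain ⟨y, rfl⟩ := hev x
    rw [hinj.mem_set_image, Set.mem_ofPred_eq, hmem, hconj, hinj.eq_iff, _root_.funext_iff]
    rfl
  have hwN : (pointFiber (MvPolynomial σ ℝ) (MvPolynomial.aeval w :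
      MvPolynomial ι ℝ →ₐ[ℝ] ℝ)).ncard = N := by
    rw [hset, Set.ncard_image_of_injective _ hinj, hw]
  have hfree : FreeFiber τ (MvPolynomial.aeval w₀ : MvPolynomial ι ℝ →ₐ[ℝ] ℝ) := by
    intro x hx
    obtain ⟨y, rfl⟩ := hev x
    rw [hcomp, Ne, hinj.eq_iff]
    exact (hw₀ y ((hmem _ _).1 hx)).1
  have hswap : ∀ x ∈ pointFiber (MvPolynomial σ ℝ) (MvPolynomial.aeval w₀ :
      MvPolynomial ι ℝ →ₐ[ℝ] ℝ),
      conjPoint (x.comp ((τ.restrictScalars ℝ : MvPolynomial σ ℝ ≃ₐ[ℝ] MvPolynomial σ ℝ) :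
          MvPolynomial σ ℝ →ₐ[ℝ] MvPolynomial σ ℝ)) ≠ x := by
    intro x hx
    obtain ⟨y, rfl⟩ := hev x
    rw [hcomp, hconj, Ne, hinj.eq_iff]
    exact (hw₀ y ((hmem _ _).1 hx)).2
  have hle := hrank.trans hwN.ge
  have hfree' := freeFiber_of_finrank_le (FractionRing (MvPolynomial ι ℝ)) (FractionRing
      (MvPolynomial σ ℝ)) hτ hτ' hle
  have := ncard_conjPoint_fixed_modEq (FractionRing (MvPolynomial ι ℝ)) (FractionRing (MvPolynomial
      σ ℝ)) hτ hτ' hle hfree hswap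
    (sameSign_of_freeFiber (FractionRing (MvPolynomial ι ℝ)) (FractionRing (MvPolynomial σ ℝ)) halg
        hτ hτ' hτX hq hcard' hfree' hfree)
  rwa [hset', Set.ncard_image_of_injective _ hinj, hwN] at this

end WeightedMap

section ChartPolynomial

variable {m : ℕ} {R : Type*} [CommRing R] [Algebra ℝ R]

/-- The polynomial `det (1 + Y * S)`, where `S i j = c i j * t ^ (2 * m - 1 - i - j)`. -/
noncomputable def chartPoly (c : Matrix (Fin m) (Fin m) ℝ) (Y : Matrix (Fin m) (Fin m) R) : R[X] :=
  (1 + Y.map C * Matrix.of fun i j : Fin m =>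
    monomial (2 * m - 1 - i - j) (algebraMap ℝ R (c i j))).det

theorem chartPoly_transpose {c : Matrix (Fin m) (Fin m) ℝ} (hc : c.transpose = c)
    (Y : Matrix (Fin m) (Fin m) R) : chartPoly c Y.transpose = chartPoly c Y := by
  have hS : (Matrix.of fun i j : Fin m =>
      monomial (2 * m - 1 - i - j) (algebraMap ℝ R (c i j))).transpose =
      Matrix.of fun i j : Fin m => monomial (2 * m - 1 - i - j) (algebraMap ℝ R (c i j)) := by
    ext1 i j
    simp only [Matrix.transpose_apply, Matrix.of_apply]
    rw [show c j i = c i j from congrFun (congrFun hc i) j, Nat.sub_right_comm]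
  rw [chartPoly, chartPoly, Matrix.det_one_add_mul_comm, ← Matrix.det_transpose]
  rw [Matrix.transpose_add, Matrix.transpose_mul, hS, Matrix.transpose_one, Matrix.transpose_map,
    Matrix.transpose_transpose]

theorem chartPoly_map {R' : Type*} [CommRing R'] [Algebra ℝ R'] (φ : R →ₐ[ℝ] R')
    (c : Matrix (Fin m) (Fin m) ℝ) (Y : Matrix (Fin m) (Fin m) R) :
    (chartPoly c Y).map (φ : R →+* R') = chartPoly c (Y.map φ) := by
  rw [chartPoly, chartPoly, ← coe_mapRingHom, RingHom.map_det]
  congr 1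
  rw [map_add, map_one, map_mul]
  congr 1
  congr 1
  · ext1 i j
    simp
  · ext1 i j
    simp

theorem coeff_zero_chartPoly (c : Matrix (Fin m) (Fin m) ℝ) (Y : Matrix (Fin m) (Fin m) R) :
    (chartPoly c Y).coeff 0 = 1 := by
  rw [coeff_zero_eq_eval_zero, chartPoly, ← coe_evalRingHom, RingHom.map_det, map_add, map_one,
    map_mul]
  have : (evalRingHom (0 : R)).mapMatrix (Matrix.of fun i j : Fin m =>
      monomial (2 * m - 1 - i - j) (algebraMap ℝ R (c i j))) = 0 := by
    ext1 i j
    have : 2 * m - 1 - (i : ℕ) - j ≠ 0 := by omega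
    simp [this]
  rw [this, mul_zero, add_zero, Matrix.det_one]

/-- The coefficients of `p` are weighted homogeneous, with weight shifted by `b - a`. -/
def HasShiftedWeight {σ : Type*} (h : σ → ℕ) (p : (MvPolynomial σ ℝ)[X]) (a b : ℕ) : Prop :=
  ∀ n u, (p.coeff n).coeff u ≠ 0 → Finsupp.weight h u + a = n + b

namespace HasShiftedWeight

variable {σ : Type*} {h : σ → ℕ} {p p' : (MvPolynomial σ ℝ)[X]} {a b a' b' : ℕ}

theorem add (hp : HasShiftedWeight h p a b) (hp' : HasShiftedWeight h p' a b) :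
    HasShiftedWeight h (p + p') a b := by
  intro n u hu
  rw [coeff_add, MvPolynomial.coeff_add] at hu
  by_cases h0 : (p.coeff n).coeff u = 0
  · exact hp' n u (by simpa [h0] using hu)
  · exact hp n u h0

theorem zero : HasShiftedWeight h 0 a b := fun n u hu => by simp at hu

theorem sum {ι : Type*} (s : Finset ι) {f : ι → (MvPolynomial σ ℝ)[X]}
    (hf : ∀ i ∈ s, HasShiftedWeight h (f i) a b) : HasShiftedWeight h (∑ i ∈ s, f i) a b :=
  Finset.sum_induction f (HasShiftedWeight h · a b) (fun _ _ => add) zero hf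

theorem mul (hp : HasShiftedWeight h p a b) (hp' : HasShiftedWeight h p' a' b') :
    HasShiftedWeight h (p * p') (a + a') (b + b') := by
  classical
  intro n u hu
  rw [coeff_mul, MvPolynomial.coeff_sum] at hu
  obtain ⟨⟨i, j⟩, hij, hne⟩ := Finset.exists_ne_zero_of_sum_ne_zero hu
  rw [MvPolynomial.coeff_mul] at hne
  obtain ⟨⟨v, v'⟩, hv, hne⟩ := Finset.exists_ne_zero_of_sum_ne_zero hne
  have h1 := hp i v (left_ne_zero_of_mul hne)
  have h2 := hp' j v' (right_ne_zero_of_mul hne)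
  rw [Finset.HasAntidiagonal.mem_antidiagonal] at hij hv
  simp only at hij hv
  rw [← hv, map_add, ← hij]
  omega

theorem prod {ι : Type*} (s : Finset ι) {f : ι → (MvPolynomial σ ℝ)[X]} {a b : ι → ℕ}
    (hf : ∀ i ∈ s, HasShiftedWeight h (f i) (a i) (b i)) :
    HasShiftedWeight h (∏ i ∈ s, f i) (∑ i ∈ s, a i) (∑ i ∈ s, b i) := by
  classical
  induction s using Finset.induction_on with
  | empty =>
    intro n u hu
    simp only [Finset.prod_empty, coeff_one] at hu
    split_ifs at hu with hn
    · rw [MvPolynomial.coeff_one] at hu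
      split_ifs at hu with hu0
      · simp [hn, ← hu0]
      · exact absurd rfl hu
    · simp at hu
  | insert i s hi ih =>
    rw [Finset.prod_insert hi, Finset.sum_insert hi, Finset.sum_insert hi]
    exact (hf i (Finset.mem_insert_self _ _)).mul (ih fun j hj =>
        hf j (Finset.mem_insert_of_mem hj))

theorem det {A : Matrix (Fin m) (Fin m) (MvPolynomial σ ℝ)[X]}
    (hA : ∀ i j : Fin m, HasShiftedWeight h (A i j) i j) : HasShiftedWeight h A.det 0 0 := by
  rw [Matrix.det_apply']
  refine sum _ fun π _ => ?_
  intro n u hu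
  have hsign (P : (MvPolynomial σ ℝ)[X]) (ε : ℤˣ) (hP : (P.coeff n).coeff u = 0) :
      ((((ε : ℤ) : (MvPolynomial σ ℝ)[X]) * P).coeff n).coeff u = 0 := by
    rcases Int.units_eq_one_or ε with rfl | rfl
    · simp [hP]
    · have : (((-1 : ℤˣ) : ℤ) : (MvPolynomial σ ℝ)[X]) * P = -P := by push_cast; ring
      rw [this, Polynomial.coeff_neg, MvPolynomial.coeff_neg, hP, neg_zero]
  have hne : ((∏ i, A (π i) i).coeff n).coeff u ≠ 0 := fun h0 => hu (hsign _ _ h0)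
  have h1 := prod Finset.univ (fun i _ => hA (π i) i) n u hne
  rw [Equiv.sum_comp π (fun i => (i : ℕ))] at h1
  omega

end HasShiftedWeight

/-- The matrix of variables. -/
noncomputable def genericMatrix (m : ℕ) : Matrix (Fin m) (Fin m) (MvPolynomial (Fin m × Fin m) ℝ) :=
  Matrix.of fun i j => MvPolynomial.X (i, j)

theorem hasShiftedWeight_chartPoly (c : Matrix (Fin m) (Fin m) ℝ) :
    HasShiftedWeight (fun p : Fin m × Fin m => 2 * m - 1 - p.1 - p.2)
      (chartPoly c (genericMatrix m)) 0 0 := by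
  refine HasShiftedWeight.det fun i j => ?_
  rw [Matrix.add_apply]
  refine HasShiftedWeight.add ?_ ?_
  · intro n u hu
    rw [Matrix.one_apply] at hu
    split_ifs at hu with hij
    · rw [coeff_one] at hu
      split_ifs at hu with hn
      · rw [MvPolynomial.coeff_one] at hu
        split_ifs at hu with hu0
        · simp [hn, ← hu0, hij]
        · exact absurd rfl hu
      · simp at hu
    · simp at hu
  · rw [Matrix.mul_apply]
    refine HasShiftedWeight.sum _ fun l _ => ?_
    intro n u hu
    simp only [Matrix.map_apply, Matrix.of_apply, genericMatrix, coeff_C_mul, coeff_monomial] at hu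
    split_ifs at hu with hn
    · rw [mul_comm, MvPolynomial.algebraMap_eq, MvPolynomial.coeff_C_mul,
        MvPolynomial.coeff_X] at hu
      split_ifs at hu with hu0
      · rw [← hu0, ← hn, Finsupp.weight_single]
        simp only [one_smul]
        omega
      · simp at hu
    · simp at hu

theorem isWeightedHomogeneous_coeff_chartPoly (c : Matrix (Fin m) (Fin m) ℝ) (n : ℕ) :
    MvPolynomial.IsWeightedHomogeneous (fun p : Fin m × Fin m => 2 * m - 1 - p.1 - p.2)
      ((chartPoly c (genericMatrix m)).coeff n) n := by
  intro u hu
  have := hasShiftedWeight_chartPoly c n u hu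
  simpa using this

theorem aeval_coeff_chartPoly (c : Matrix (Fin m) (Fin m) ℝ) (x : Fin m × Fin m → R) (n : ℕ) :
    MvPolynomial.aeval x ((chartPoly c (genericMatrix m)).coeff n) =
      (chartPoly c (Matrix.of fun i j => x (i, j))).coeff n := by
  have h := chartPoly_map (MvPolynomial.aeval x : _ →ₐ[ℝ] R) c (genericMatrix m)
  have h2 : (genericMatrix m).map (MvPolynomial.aeval x : _ →ₐ[ℝ] R) =
      Matrix.of fun i j => x (i, j) := by
    ext1 i j
    simp [genericMatrix]
  rw [← h2, ← h, coeff_map]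
  rfl

theorem rename_swap_coeff_chartPoly {c : Matrix (Fin m) (Fin m) ℝ} (hc : c.transpose = c) (n : ℕ) :
    MvPolynomial.rename Prod.swap ((chartPoly c (genericMatrix m)).coeff n) =
      (chartPoly c (genericMatrix m)).coeff n := by
  have h : MvPolynomial.rename (R := ℝ) (Prod.swap : Fin m × Fin m → Fin m × Fin m) =
      MvPolynomial.aeval fun p => MvPolynomial.X p.swap := by
    refine MvPolynomial.algHom_ext fun p => ?_
    simp
  rw [h, aeval_coeff_chartPoly]
  have h2 : (Matrix.of fun i j : Fin m => MvPolynomial.X (R := ℝ) (i, j).swap) =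
      (genericMatrix m).transpose := by
    ext1 i j
    simp [genericMatrix]
  rw [h2, chartPoly_transpose hc]

end ChartPolynomial

section WronskianFrame

theorem sum_antidiagonal_choose_mul_choose (M d : ℕ) :
    ∑ x ∈ Finset.HasAntidiagonal.antidiagonal M,
      ((M + d + 1).choose x.1 : ℤ) * ((-1) ^ x.2 * (x.2 + d).choose x.2) = 1 := by
  have h := Ring.add_choose_eq (R := ℤ) (r := ((M + d + 1 : ℕ) : ℤ)) (s := -((d + 1 : ℕ) : ℤ)) M
    (Commute.all _ _)
  rw [show ((M + d + 1 : ℕ) : ℤ) + -((d + 1 : ℕ) : ℤ) = (M : ℕ) by push_cast; ring,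
    Ring.choose_natCast, Nat.choose_self] at h
  rw [Nat.cast_one] at h
  refine Eq.trans ?_ h.symm
  refine Finset.sum_congr rfl fun x _ => ?_
  rw [Ring.choose_natCast, Ring.choose_neg,
    show ((d + 1 : ℕ) : ℤ) + (x.2 : ℤ) - 1 = ((x.2 + d : ℕ) : ℤ) by push_cast; ring,
    Ring.choose_natCast]
  rfl

/-- The monomial `t ^ k / k!`. -/
noncomputable def divMonomial (k : ℕ) : ℂ[X] := monomial k ((k.factorial : ℂ)⁻¹)

theorem iterate_derivative_divMonomial (i k : ℕ) :
    derivative^[i] (divMonomial k) = if i ≤ k then divMonomial (k - i) else 0 := by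
  rw [divMonomial, ← C_mul_X_pow_eq_monomial, iterate_derivative_C_mul,
    iterate_derivative_X_pow_eq_C_mul, ← mul_assoc, ← C_mul, C_mul_X_pow_eq_monomial]
  split_ifs with h
  · rw [divMonomial]
    congr 1
    have := Nat.factorial_mul_descFactorial h
    have h1 : (k.factorial : ℂ) ≠ 0 := by exact_mod_cast k.factorial_ne_zero
    have h2 : ((k - i).factorial : ℂ) ≠ 0 := by exact_mod_cast (k - i).factorial_ne_zero
    field_simp
    rw [mul_comm]
    exact_mod_cast this
  · rw [Nat.descFactorial_of_lt (by omega)]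
    simp

/-- The coefficients of the Wronskian of a frame as a function of the chart coordinates. -/
noncomputable def hankelCoeff (m : ℕ) : Matrix (Fin m) (Fin m) ℝ :=
  Matrix.of fun j l => (-1) ^ (m - 1 + j + l) *
    (2 * m - 2 - j - l).choose (m - 1 - l) / (2 * m - 1 - j - l : ℕ).factorial

theorem hankelCoeff_transpose (m : ℕ) : (hankelCoeff m).transpose = hankelCoeff m := by
  ext1 j l
  simp only [hankelCoeff, Matrix.transpose_apply, Matrix.of_apply]
  rw [Nat.sub_right_comm (2 * m - 1), Nat.sub_right_comm (2 * m - 2), Nat.add_right_comm (m - 1)]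
  rw [Nat.choose_symm_of_eq_add (show 2 * m - 2 - (j : ℕ) - l = (m - 1 - j) + (m - 1 - l) by omega)]

theorem sum_hankelCoeff_mul {m : ℕ} (l i : Fin m) :
    ∑ r : Fin m, monomial (2 * m - 1 - l - r) (algebraMap ℝ ℂ (hankelCoeff m l r)) *
      (if (i : ℕ) ≤ r then divMonomial (r - i) else 0) =
      C ((-1) ^ (l : ℕ)) * divMonomial (2 * m - 1 - l - i) := by
  obtain ⟨l, hl⟩ := l
  obtain ⟨i, hi⟩ := i
  obtain ⟨M, rfl⟩ : ∃ M, m = i + (M + 1) := ⟨m - i - 1, by omega⟩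
  obtain ⟨d, hd⟩ : ∃ d, i + (M + 1) = l + d + 1 := ⟨i + M - l, by omega⟩
  have hn : 2 * (i + (M + 1)) - 1 - l - i = M + d + 1 := by omega
  simp only [hankelCoeff, Matrix.of_apply]
  rw [Fin.sum_univ_eq_sum_range (fun r => monomial (2 * (i + (M + 1)) - 1 - l - r)
    (algebraMap ℝ ℂ ((-1) ^ (i + (M + 1) - 1 + l + r) *
    (2 * (i + (M + 1)) - 2 - l - r).choose (i + (M + 1) - 1 - r) /
      (2 * (i + (M + 1)) - 1 - l - r : ℕ).factorial)) *
      (if i ≤ r then divMonomial (r - i) else 0)) (i + (M + 1)), Finset.sum_range_add,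
    Finset.sum_eq_zero (s := Finset.range i), zero_add]
  · refine (Finset.Nat.sum_antidiagonal_eq_sum_range_succ
      (fun x (_ : ℕ) => (?g : ℕ → ℂ[X]) x) M).symm.trans ?_
    rw [hn]
    have hid := congrArg (Int.cast : ℤ → ℂ) (sum_antidiagonal_choose_mul_choose M d)
    have hC (z : ℂ) (hz : z = 1) : C ((-1) ^ l) * divMonomial (M + d + 1) = monomial (M + d + 1)
        ((-1) ^ l * ((M + d + 1).factorial : ℂ)⁻¹ * z) := by
      rw [divMonomial, C_mul_monomial, hz, mul_one]
    push_cast at hid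
    rw [hC _ hid, Finset.mul_sum, map_sum]
    refine Finset.sum_congr rfl fun x hx => ?_
    rw [Finset.HasAntidiagonal.mem_antidiagonal] at hx
    obtain ⟨s, a⟩ := x
    simp only at hx ⊢
    subst hx
    rw [if_pos (by omega), divMonomial, monomial_mul_monomial,
      show 2 * (i + (s + a + 1)) - 1 - l - (i + s) = a + d + 1 by omega,
      show 2 * (i + (s + a + 1)) - 2 - l - (i + s) = a + d by omega,
      show i + (s + a + 1) - 1 - (i + s) = a by omega,
      show i + s - i = s by omega,
      show a + d + 1 + s = s + a + d + 1 by omega,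
      show i + (s + a + 1) - 1 + l + (i + s) = l + a + 2 * (i + s) by omega]
    congr 1
    have h1 : ((s + a + d + 1).choose s : ℂ) * s.factorial * (a + d + 1).factorial =
        (s + a + d + 1).factorial := by
      have := Nat.choose_mul_factorial_mul_factorial (show s ≤ s + a + d + 1 by omega)
      rw [show s + a + d + 1 - s = a + d + 1 by omega] at this
      exact_mod_cast this
    have h2 : (s.factorial : ℂ) ≠ 0 := by exact_mod_cast s.factorial_ne_zero
    have h3 : ((a + d + 1).factorial : ℂ) ≠ 0 := by exact_mod_cast (a + d + 1).factorial_ne_zero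
    have h4 : ((s + a + d + 1).factorial : ℂ) ≠ 0 := by
      exact_mod_cast (s + a + d + 1).factorial_ne_zero
    rw [pow_add, pow_add, pow_mul]
    simp only [Complex.coe_algebraMap]
    push_cast
    rw [← h1] at h4 ⊢
    rw [mul_ne_zero_iff, mul_ne_zero_iff] at h4
    have h5 := h4.1.1
    field_simp
    norm_num
  · intro r hr
    rw [Finset.mem_range] at hr
    rw [if_neg (by omega), mul_zero]

/-- The frame of polynomials with chart coordinates `Y`. -/
noncomputable def frame {m : ℕ} (Y : Matrix (Fin m) (Fin m) ℂ) (i : Fin m) : ℂ[X] :=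
  divMonomial i + ∑ l : Fin m, C (Y i l * (-1) ^ (l : ℕ)) * divMonomial (2 * m - 1 - l)

theorem Wr_frame {m : ℕ} (Y : Matrix (Fin m) (Fin m) ℂ) :
    Wr (frame Y) = chartPoly (hankelCoeff m) Y := by
  have hdet : (Matrix.of fun r i : Fin m =>
      if (i : ℕ) ≤ r then divMonomial (r - i) else 0).det = 1 := by
    rw [Matrix.det_of_isLowerTriangular]
    · refine Finset.prod_eq_one fun i _ => ?_
      simp [divMonomial]
    · intro r i hri
      have : r < i := hri
      simp [this.not_ge]
  rw [Wr, chartPoly, ← Matrix.det_transpose, ← mul_one (Matrix.det (1 + _)), ← hdet,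
    ← Matrix.det_mul]
  congr 1
  rw [add_mul, one_mul, mul_assoc]
  ext1 j i
  rw [Matrix.add_apply, Matrix.mul_apply]
  simp only [Matrix.transpose_apply, Matrix.of_apply, Matrix.map_apply]
  rw [frame, iterate_map_add derivative, iterate_derivative_divMonomial, iterate_derivative_sum]
  congr 1
  refine Finset.sum_congr rfl fun l _ => ?_
  rw [Matrix.mul_apply]
  simp only [Matrix.of_apply]
  rw [sum_hankelCoeff_mul, iterate_derivative_C_mul, iterate_derivative_divMonomial,
    if_pos (by omega), C_mul, mul_assoc]

end WronskianFrame

section WronskianDegree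

theorem linearIndependent_of_injective_natDegree {K ι : Type*} [Field K] {g : ι → K[X]}
    (hg : ∀ i, g i ≠ 0) (hinj : Function.Injective fun i => (g i).natDegree) :
    LinearIndependent K g := by
  rw [linearIndependent_iff']
  intro s a h0 i hi
  by_contra hai
  have hpair : {i | i ∈ s ∧ a i • g i ≠ 0}.Pairwise (Function.onFun Ne
      (degree ∘ fun i => a i • g i)) := by
    intro x hx y hy hxy h
    have hx' : a x ≠ 0 := fun h => hx.2 (by simp [h])
    have hy' : a y ≠ 0 := fun h => hy.2 (by simp [h])
    simp only [Function.comp_apply, smul_eq_C_mul, degree_C_mul hx', degree_C_mul hy'] at h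
    exact hxy (hinj (natDegree_eq_of_degree_eq h))
  have h1 := degree_sum_eq_of_disjoint (fun i => a i • g i) s hpair
  rw [h0, degree_zero] at h1
  have h2 : (a i • g i).degree ≤ s.sup fun i => (a i • g i).degree :=
    Finset.le_sup (f := fun i => (a i • g i).degree) hi
  rw [← h1, le_bot_iff, degree_eq_bot, smul_eq_zero] at h2
  exact h2.elim hai (hg i)

/-- A finite-dimensional space of polynomials has a basis with distinct degrees. -/
theorem exists_injective_natDegree {K : Type*} [Field K] {m n : ℕ} {f : Fin m → K[X]}
    (hf : LinearIndependent K f) (hn : ∀ i, f i ∈ degreeLT K n) :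
    ∃ g : Fin m → K[X], (∀ i, g i ≠ 0) ∧ (Function.Injective fun i => (g i).natDegree) ∧
      Submodule.span K (Set.range g) = Submodule.span K (Set.range f) := by
  classical
  set H := Submodule.span K (Set.range f) with hH
  have hHn : H ≤ degreeLT K n := by
    rw [hH, Submodule.span_le]
    rintro _ ⟨i, rfl⟩
    exact hn i
  have hrank : Module.finrank K H = m := by rw [finrank_span_eq_card hf, Fintype.card_fin]
  have hfd : FiniteDimensional K H := FiniteDimensional.span_of_finite K (Set.finite_range f)
  set D : Finset ℕ := (Finset.range n).filter fun d => ∃ p ∈ H, p ≠ 0 ∧ p.natDegree = d with hD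
  let L : H →ₗ[K] D → K := LinearMap.pi fun d => (lcoeff K d).comp H.subtype
  have hL : Function.Injective L := by
    rw [injective_iff_map_eq_zero]
    rintro ⟨p, hp⟩ h0
    by_contra hne
    have hp0 : p ≠ 0 := fun h => hne (by simp [h])
    have hd : p.natDegree ∈ D := by
      rw [hD, Finset.mem_filter, Finset.mem_range]
      exact ⟨(natDegree_lt_iff_degree_lt hp0).mpr (mem_degreeLT.mp (hHn hp)), p, hp, hp0, rfl⟩
    have h1 := congrFun h0 ⟨p.natDegree, hd⟩
    have h2 : p.coeff p.natDegree = 0 := h1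
    exact hp0 (leadingCoeff_eq_zero.mp h2)
  have hcard : m ≤ D.card := by
    have := LinearMap.finrank_le_finrank_of_injective hL
    rw [hrank] at this
    simpa using this
  obtain ⟨T, hT, hTm⟩ := Finset.exists_subset_card_eq hcard
  have hex (i : Fin m) : ∃ p ∈ H, p ≠ 0 ∧ p.natDegree = T.orderEmbOfFin hTm i :=
    (Finset.mem_filter.mp (hT (T.orderEmbOfFin_mem hTm i))).2
  choose g hgH hg0 hgd using hex
  have hinj : Function.Injective fun i => (g i).natDegree := by
    intro i j hij
    simp only [hgd] at hij
    exact (T.orderEmbOfFin hTm).injective hij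
  refine ⟨g, hg0, hinj, ?_⟩
  have hle : Submodule.span K (Set.range g) ≤ H := by
    rw [Submodule.span_le]
    rintro _ ⟨i, rfl⟩
    exact hgH i
  refine Submodule.eq_of_le_of_finrank_eq hle ?_
  rw [hrank, finrank_span_eq_card (linearIndependent_of_injective_natDegree hg0 hinj),
    Fintype.card_fin]

theorem natDegree_prod_le_and_coeff {R ι : Type*} [CommRing R] (s : Finset ι) {p : ι → R[X]}
    {d : ι → ℕ} (h : ∀ i ∈ s, (p i).natDegree ≤ d i) :
    (∏ i ∈ s, p i).natDegree ≤ ∑ i ∈ s, d i ∧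
      (∏ i ∈ s, p i).coeff (∑ i ∈ s, d i) = ∏ i ∈ s, (p i).coeff (d i) := by
  classical
  induction s using Finset.induction_on with
  | empty => simp
  | insert i s hi ih =>
    obtain ⟨h1, h2⟩ := ih fun j hj => h j (Finset.mem_insert_of_mem hj)
    have h3 := h i (Finset.mem_insert_self _ _)
    rw [Finset.prod_insert hi, Finset.sum_insert hi, Finset.prod_insert hi]
    exact ⟨natDegree_mul_le_of_le h3 h1, by
      rw [coeff_mul_add_eq_of_natDegree_le h3 h1, h2]⟩

theorem natDegree_det_le_and_coeff {R : Type*} [CommRing R] {m : ℕ}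
    (A : Matrix (Fin m) (Fin m) R[X]) {d : Fin m → ℕ} (h : ∀ i j, (A i j).natDegree ≤ d j) :
    A.det.natDegree ≤ ∑ j, d j ∧
      A.det.coeff (∑ j, d j) = (Matrix.of fun i j => (A i j).coeff (d j)).det := by
  rw [Matrix.det_apply, Matrix.det_apply]
  constructor
  · refine natDegree_sum_le_of_forall_le _ _ fun σ _ => ?_
    refine (natDegree_smul_le _ _).trans ?_
    exact (natDegree_prod_le_and_coeff Finset.univ fun j _ => h (σ j) j).1
  · rw [finsetSum_coeff]
    refine Finset.sum_congr rfl fun σ _ => ?_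
    rw [coeff_smul, (natDegree_prod_le_and_coeff Finset.univ fun j _ => h (σ j) j).2]
    rfl

theorem Wr_ne_zero_and_natDegree {m : ℕ} {g : Fin m → ℂ[X]} (hg : ∀ i, g i ≠ 0)
    (hinj : Function.Injective fun i => (g i).natDegree) :
    Wr g ≠ 0 ∧ (Wr g).natDegree + ∑ i : Fin m, (i : ℕ) = ∑ i, (g i).natDegree := by
  set A : Matrix (Fin m) (Fin m) ℂ[X] :=
    Matrix.of fun i j => X ^ (i : ℕ) * derivative^[(i : ℕ)] (g j) with hA
  have hdet : A.det = X ^ (∑ i : Fin m, (i : ℕ)) * Wr g := by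
    rw [← Finset.prod_pow_eq_pow_sum, Wr, ← Matrix.det_mul_column]
    rfl
  have hle (i j : Fin m) : (A i j).natDegree ≤ (g j).natDegree := by
    rw [hA, Matrix.of_apply]
    by_cases hij : (g j).natDegree < i
    · rw [iterate_derivative_eq_zero hij, mul_zero, natDegree_zero]
      exact Nat.zero_le _
    · refine natDegree_mul_le.trans ?_
      rw [natDegree_X_pow]
      have := natDegree_iterate_derivative (g j) i
      omega
  have hco (i j : Fin m) : (A i j).coeff (g j).natDegree =
      (g j).leadingCoeff * ((g j).natDegree.descFactorial i : ℂ) := by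
    rw [hA, Matrix.of_apply, coeff_X_pow_mul']
    split_ifs with hij
    · rw [coeff_iterate_derivative, Nat.sub_add_cancel hij, nsmul_eq_mul, mul_comm]
      rfl
    · rw [Nat.descFactorial_of_lt (by omega)]
      simp
  obtain ⟨h1, h2⟩ := natDegree_det_le_and_coeff A hle
  have h3 : (Matrix.of fun i j => (A i j).coeff (g j).natDegree).det ≠ 0 := by
    have : (Matrix.of fun i j => (A i j).coeff (g j).natDegree) = Matrix.of fun i j =>
        (g j).leadingCoeff * (Matrix.of fun i j : Fin m =>
          (descPochhammer ℂ j).eval ((g i).natDegree : ℂ)).transpose i j := by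
      ext1 i j
      simp only [Matrix.of_apply, Matrix.transpose_apply]
      rw [hco, descPochhammer_eval_eq_descFactorial]
    rw [this, Matrix.det_mul_row, Matrix.det_transpose,
      ← Matrix.det_eval_matrixOfPolynomials_eq_det_vandermonde _ _
        (fun i => descPochhammer_natDegree ℂ i) fun i => monic_descPochhammer ℂ i]
    refine mul_ne_zero (Finset.prod_ne_zero_iff.mpr fun i _ =>
      leadingCoeff_ne_zero.mpr (hg i)) ?_
    rw [Matrix.det_vandermonde_ne_zero_iff]
    intro i j hij
    exact hinj (Nat.cast_injective (R := ℂ) hij)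
  have h4 : A.det.natDegree = ∑ j, (g j).natDegree :=
    natDegree_eq_of_le_of_coeff_ne_zero h1 (by rwa [h2])
  have h5 : Wr g ≠ 0 := by
    intro h0
    rw [h0, mul_zero] at hdet
    rw [hdet, coeff_zero] at h2
    exact h3 h2.symm
  refine ⟨h5, ?_⟩
  rw [← h4, hdet, natDegree_mul (pow_ne_zero _ X_ne_zero) h5, natDegree_X_pow, add_comm]

theorem Wr_eq_C_mul {K : Type*} [Field K] {m : ℕ} {f g : Fin m → K[X]}
    (h : ∀ i, f i ∈ Submodule.span K (Set.range g)) : ∃ a : K, Wr f = C a * Wr g := by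
  simp only [Submodule.mem_span_range_iff_exists_fun] at h
  choose P hP using h
  refine ⟨(Matrix.of fun k j => P j k).det, ?_⟩
  rw [mul_comm, Wr, Wr, RingHom.map_det, ← Matrix.det_mul]
  congr 1
  ext1 i j
  rw [Matrix.mul_apply, Matrix.of_apply, ← hP, iterate_derivative_sum]
  refine Finset.sum_congr rfl fun k _ => ?_
  rw [smul_eq_C_mul, iterate_derivative_C_mul, mul_comm]
  rfl

theorem Wr_eq_C_mul_of_span_eq {m : ℕ} {f g : Fin m → ℂ[X]}
    (hg : Wr g ≠ 0)
    (h : Submodule.span ℂ (Set.range f) = Submodule.span ℂ (Set.range g)) :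
    ∃ a : ℂ, a ≠ 0 ∧ Wr f = C a * Wr g := by
  obtain ⟨a, ha⟩ := Wr_eq_C_mul (f := f) (g := g)
    fun i => h ▸ Submodule.subset_span (Set.mem_range_self i)
  obtain ⟨b, hb⟩ := Wr_eq_C_mul (f := g) (g := f)
    fun i => h ▸ Submodule.subset_span (Set.mem_range_self i)
  refine ⟨a, ?_, ha⟩
  rintro rfl
  rw [ha] at hb
  simp only [map_zero, zero_mul, mul_zero] at hb
  exact hg hb

theorem exists_natDegree_Wr {m n : ℕ} {f : Fin m → ℂ[X]} (hf : LinearIndependent ℂ f)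
    (hn : ∀ i, f i ∈ degreeLT ℂ n) :
    ∃ g : Fin m → ℂ[X], (∀ i, g i ≠ 0) ∧ (Function.Injective fun i => (g i).natDegree) ∧
      Submodule.span ℂ (Set.range g) = Submodule.span ℂ (Set.range f) ∧
      (Wr f).natDegree + ∑ i : Fin m, (i : ℕ) = ∑ i, (g i).natDegree := by
  obtain ⟨g, hg0, hinj, hspan⟩ := exists_injective_natDegree hf hn
  obtain ⟨h1, h2⟩ := Wr_ne_zero_and_natDegree hg0 hinj
  obtain ⟨a, ha, h3⟩ := Wr_eq_C_mul_of_span_eq h1 hspan.symm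
  exact ⟨g, hg0, hinj, hspan, by rw [h3, natDegree_C_mul ha, h2]⟩

end WronskianDegree

section DegreeSets

theorem sum_fin_add_card_le_sum {m : ℕ} {d : Fin m → ℕ} (hd : Function.Injective d) :
    ∑ i : Fin m, (i : ℕ) + (Finset.univ.filter fun i => m ≤ d i).card ≤ ∑ i, d i := by
  classical
  set s := Finset.univ.image d with hs
  have hcs : s.card = m := by rw [hs, Finset.card_image_of_injective _ hd, Finset.card_fin]
  have hsum : ∑ i, d i = ∑ x ∈ s, x := by
    rw [hs, Finset.sum_image fun i _ j _ h => hd h]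
  have hflt : (Finset.univ.filter fun i => m ≤ d i).card = (s \ Finset.range m).card := by
    rw [← Finset.card_image_of_injective _ hd]
    congr 1
    ext x
    simp only [hs, Finset.mem_image, Finset.mem_filter, Finset.mem_univ, true_and,
      Finset.mem_sdiff, Finset.mem_range, not_lt]
    constructor
    · rintro ⟨i, hi, rfl⟩
      exact ⟨⟨i, rfl⟩, hi⟩
    · rintro ⟨⟨i, rfl⟩, hi⟩
      exact ⟨i, hi, rfl⟩
  have hcard : (Finset.range m \ s).card = (s \ Finset.range m).card :=
    Finset.card_sdiff_comm (by rw [hcs, Finset.card_range])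
  rw [Fin.sum_univ_eq_sum_range (fun i => i), hsum, hflt,
    ← Finset.sum_inter_add_sum_sdiff s (Finset.range m) (fun x => x),
    ← Finset.sum_inter_add_sum_sdiff (Finset.range m) s (fun x => x), Finset.inter_comm, add_assoc]
  refine Nat.add_le_add_left ?_ _
  have h1 : ∑ x ∈ Finset.range m \ s, (x + 1) ≤ (Finset.range m \ s).card * m := by
    rw [← smul_eq_mul]
    refine Finset.sum_le_card_nsmul _ _ _ fun x hx => ?_
    have := Finset.mem_range.mp (Finset.mem_sdiff.mp hx).1
    omega
  have h2 : (s \ Finset.range m).card * m ≤ ∑ x ∈ s \ Finset.range m, x := by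
    rw [← smul_eq_mul]
    refine Finset.card_nsmul_le_sum _ _ _ fun x hx => ?_
    have := (Finset.mem_sdiff.mp hx).2
    rw [Finset.mem_range] at this
    omega
  rw [Finset.sum_add_distrib, Finset.sum_const, smul_eq_mul, mul_one] at h1
  rw [hcard] at h1
  omega

theorem two_mul_sum_fin (m : ℕ) : 2 * ∑ i : Fin m, (i : ℕ) + m = m ^ 2 := by
  rw [Fin.sum_univ_eq_sum_range (fun i => i), mul_comm, Finset.sum_range_id_mul_two]
  cases m with
  | zero => rfl
  | succ n =>
    rw [Nat.add_sub_cancel]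
    ring

theorem sum_add_sum_reflect {m : ℕ} {d : Fin m → ℕ} (hd : ∀ i, d i < 2 * m) :
    ∑ i, d i + ∑ i, (2 * m - 1 - d i) + m = 2 * m ^ 2 := by
  rw [← Finset.sum_add_distrib, Finset.sum_congr rfl (g := fun _ => 2 * m - 1)
    fun i _ => by have := hd i; omega]
  rw [Finset.sum_const, Finset.card_fin, smul_eq_mul]
  cases m with
  | zero => rfl
  | succ n =>
    rw [show 2 * (n + 1) - 1 = 2 * n + 1 by omega]
    ring

theorem sum_le_sq_add_sum_fin {m : ℕ} {d : Fin m → ℕ} (hd : Function.Injective d)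
    (hlt : ∀ i, d i < 2 * m) : ∑ i, d i ≤ m ^ 2 + ∑ i : Fin m, (i : ℕ) := by
  have h1 := sum_add_sum_reflect hlt
  have h2 := two_mul_sum_fin m
  have h3 := sum_fin_add_card_le_sum (d := fun i => 2 * m - 1 - d i) fun i j hij => hd (by
    have := hlt i
    have := hlt j
    simp only at hij
    omega)
  omega

theorem sum_add_two_ne_of_add_ne {m : ℕ} {d : Fin m → ℕ} (hd : Function.Injective d)
    (hlt : ∀ i, d i < 2 * m) (hne : ∀ i j, d i + d j ≠ 2 * m - 1) :
    ∑ i, d i + 2 ≠ m ^ 2 + ∑ i : Fin m, (i : ℕ) := by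
  classical
  intro hsum
  set p : Fin m → ℕ := fun i => min (d i) (2 * m - 1 - d i) with hp
  have hpm (i : Fin m) : p i < m := by
    have := hlt i
    simp only [hp]
    omega
  have hpinj : Function.Injective p := by
    intro i j hij
    have h1 := hne i j
    have h2 := hlt i
    have h3 := hlt j
    simp only [hp] at hij
    refine hd ?_
    omega
  have hbij : Function.Bijective fun i => (⟨p i, hpm i⟩ : Fin m) := by
    rw [Fintype.bijective_iff_injective_and_card]
    exact ⟨fun i j hij => hpinj (Fin.mk.inj_iff.mp hij), rfl⟩
  have hpsum : ∑ i, p i = ∑ i : Fin m, (i : ℕ) :=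
    hbij.sum_comp (fun i : Fin m => (i : ℕ))
  set T : Finset (Fin m) := Finset.univ.filter fun i => d i < m with hT
  have hTsum : ∑ i ∈ T, (2 * m - 1 - 2 * p i) + ∑ i, d i = ∑ i, (2 * m - 1 - p i) := by
    rw [hT, Finset.sum_filter, ← Finset.sum_add_distrib]
    refine Finset.sum_congr rfl fun i _ => ?_
    have := hlt i
    simp only [hp]
    split_ifs <;> omega
  have h1 := sum_add_sum_reflect (d := p) fun i => by have := hpm i; omega
  have h2 := two_mul_sum_fin m
  have h3 : ∑ i ∈ T, (2 * m - 1 - 2 * p i) = 2 := by omega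
  rcases Nat.lt_or_ge 1 T.card with hc | hc
  · obtain ⟨a, ha, b, hb, hab⟩ := Finset.one_lt_card.mp hc
    have h4 : ∑ i ∈ {a, b}, (2 * m - 1 - 2 * p i) ≤ ∑ i ∈ T, (2 * m - 1 - 2 * p i) :=
      Finset.sum_le_sum_of_subset (Finset.insert_subset ha (Finset.singleton_subset_iff.mpr hb))
    rw [Finset.sum_pair hab, h3] at h4
    have h5 : p a ≠ p b := fun h => hab (hpinj h)
    have := hpm a
    have := hpm b
    omega
  · rcases T.eq_empty_or_nonempty with h0 | h0
    · rw [h0] at h3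
      simp at h3
    · obtain ⟨a, ha⟩ := Finset.card_eq_one.mp (le_antisymm hc h0.card_pos)
      rw [ha, Finset.sum_singleton] at h3
      omega

end DegreeSets

section Skew

/-- The invariant skew-symmetric form on polynomials of degree less than `2 * m`. -/
noncomputable def skewForm (m : ℕ) : ℂ[X] →ₗ[ℂ] ℂ[X] →ₗ[ℂ] ℂ :=
  ∑ i ∈ Finset.range (2 * m), ((-1) ^ i * (i.factorial : ℂ) * (2 * m - 1 - i : ℕ).factorial) •
    (LinearMap.mul ℂ ℂ).compl₁₂ (lcoeff ℂ i) (lcoeff ℂ (2 * m - 1 - i))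

theorem skewForm_apply (m : ℕ) (p q : ℂ[X]) :
    skewForm m p q = ∑ i ∈ Finset.range (2 * m),
      ((-1) ^ i * (i.factorial : ℂ) * (2 * m - 1 - i : ℕ).factorial) *
        (p.coeff i * q.coeff (2 * m - 1 - i)) := by
  simp [skewForm, LinearMap.sum_apply]

theorem skewForm_divMonomial {m a b : ℕ} (ha : a < 2 * m) :
    skewForm m (divMonomial a) (divMonomial b) = if a + b = 2 * m - 1 then (-1) ^ a else 0 := by
  rw [skewForm_apply, Finset.sum_eq_single_of_mem a (Finset.mem_range.mpr ha)]
  · simp only [divMonomial, coeff_monomial, if_true]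
    have h2 : (a.factorial : ℂ) ≠ 0 := by exact_mod_cast a.factorial_ne_zero
    have h3 : (b.factorial : ℂ) ≠ 0 := by exact_mod_cast b.factorial_ne_zero
    by_cases hab : a + b = 2 * m - 1
    · rw [if_pos hab, if_pos (by omega), show 2 * m - 1 - a = b by omega]
      field_simp
    · rw [if_neg hab, if_neg (by omega)]
      simp
  · intro i _ hi
    simp [divMonomial, coeff_monomial, hi.symm]

theorem skewForm_ne_zero {m : ℕ} {p q : ℂ[X]} (hp : p ≠ 0) (hq : q ≠ 0)
    (hpm : p.natDegree < 2 * m) (hpq : p.natDegree + q.natDegree = 2 * m - 1) :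
    skewForm m p q ≠ 0 := by
  rw [skewForm_apply, Finset.sum_eq_single_of_mem p.natDegree (Finset.mem_range.mpr hpm)]
  · have h2 : (p.natDegree.factorial : ℂ) ≠ 0 := by
      exact_mod_cast p.natDegree.factorial_ne_zero
    have h3 : ((2 * m - 1 - p.natDegree).factorial : ℂ) ≠ 0 := by
      exact_mod_cast (2 * m - 1 - p.natDegree).factorial_ne_zero
    refine mul_ne_zero (mul_ne_zero (mul_ne_zero (pow_ne_zero _ (by norm_num)) h2) h3)
      (mul_ne_zero (leadingCoeff_ne_zero.mpr hp) ?_)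
    rw [show 2 * m - 1 - p.natDegree = q.natDegree by omega]
    exact leadingCoeff_ne_zero.mpr hq
  · intro i hi hne
    rw [Finset.mem_range] at hi
    rcases Nat.lt_or_gt_of_ne hne with h | h
    · rw [coeff_eq_zero_of_natDegree_lt (p := q) (by omega), mul_zero, mul_zero]
    · rw [coeff_eq_zero_of_natDegree_lt (p := p) h, zero_mul, mul_zero]

theorem skewForm_frame {m : ℕ} (Y Z : Matrix (Fin m) (Fin m) ℂ) (i j : Fin m) :
    skewForm m (frame Y i) (frame Z j) = Z j i - Y i j := by
  have h1 (i j : Fin m) : skewForm m (divMonomial i) (divMonomial j) = 0 := by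
    rw [skewForm_divMonomial (by omega), if_neg (by omega)]
  have h2 (i l : Fin m) : skewForm m (divMonomial i) (divMonomial (2 * m - 1 - l)) =
      if l = i then (-1) ^ (i : ℕ) else 0 := by
    rw [skewForm_divMonomial (by omega)]
    congr 1
    simp only [Fin.ext_iff, eq_iff_iff]
    omega
  have h3 (i l : Fin m) : skewForm m (divMonomial (2 * m - 1 - l)) (divMonomial i) =
      if l = i then -(-1) ^ (i : ℕ) else 0 := by
    rw [skewForm_divMonomial (by omega)]
    by_cases hl : l = i
    · rw [if_pos hl, if_pos (by omega), hl]
      have : ((-1) ^ (2 * m - 1 - i + (i : ℕ) + 1) : ℂ) = 1 := by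
        rw [show 2 * m - 1 - i + (i : ℕ) + 1 = 2 * m by omega, pow_mul]
        norm_num
      have h4 : ((-1 : ℂ) ^ (i : ℕ)) * (-1) ^ (i : ℕ) = 1 := by
        rw [← mul_pow]
        norm_num
      rw [pow_succ, pow_add] at this
      linear_combination (-(-1 : ℂ) ^ (i : ℕ)) * this - (-1 : ℂ) ^ (2 * m - 1 - (i : ℕ)) * h4
    · rw [if_neg hl, if_neg (by simp only [Fin.ext_iff] at hl; omega)]
  have h4 (k l : Fin m) :
      skewForm m (divMonomial (2 * m - 1 - l)) (divMonomial (2 * m - 1 - k)) = 0 := by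
    rw [skewForm_divMonomial (by omega), if_neg (by omega)]
  have hs (i : Fin m) : ((-1 : ℂ) ^ (i : ℕ)) * (-1) ^ (i : ℕ) = 1 := by
    rw [← mul_pow]
    norm_num
  simp only [frame, ← smul_eq_C_mul, map_add, map_sum, map_smul, LinearMap.add_apply,
    LinearMap.sum_apply, LinearMap.smul_apply, h1, h2, h3, h4, smul_eq_mul]
  simp only [add_zero, mul_ite, mul_zero, Finset.sum_ite_eq', Finset.mem_univ, if_true,
    Finset.sum_const_zero]
  linear_combination Z j i * hs i - Y i j * hs j

theorem skewForm_span_frame {m : ℕ} (Y : Matrix (Fin m) (Fin m) ℂ) {p q : ℂ[X]}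
    (hp : p ∈ Submodule.span ℂ (Set.range (frame Y)))
    (hq : q ∈ Submodule.span ℂ (Set.range (frame Y.transpose))) : skewForm m p q = 0 := by
  obtain ⟨a, rfl⟩ := (Submodule.mem_span_range_iff_exists_fun ℂ).mp hp
  obtain ⟨b, rfl⟩ := (Submodule.mem_span_range_iff_exists_fun ℂ).mp hq
  simp only [map_sum, map_smul, LinearMap.sum_apply, LinearMap.smul_apply, skewForm_frame,
    Matrix.transpose_apply, sub_self, smul_zero, Finset.sum_const_zero]

end Skew

section FrameLemmas

variable {m : ℕ}

theorem coeff_frame (Y : Matrix (Fin m) (Fin m) ℂ) (i k : Fin m) :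
    (frame Y i).coeff k = if i = k then ((i : ℕ).factorial : ℂ)⁻¹ else 0 := by
  rw [frame, coeff_add, finsetSum_coeff, Finset.sum_eq_zero, add_zero, divMonomial, coeff_monomial]
  · simp only [Fin.ext_iff]
  · intro l _
    rw [coeff_C_mul, divMonomial, coeff_monomial, if_neg (by omega), mul_zero]

theorem coeff_frame_reflect (Y : Matrix (Fin m) (Fin m) ℂ) (i l : Fin m) :
    (frame Y i).coeff (2 * m - 1 - l) =
      Y i l * (-1) ^ (l : ℕ) * ((2 * m - 1 - l : ℕ).factorial : ℂ)⁻¹ := by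
  rw [frame, coeff_add, finsetSum_coeff, Finset.sum_eq_single l, divMonomial, coeff_monomial,
    if_neg (by omega), zero_add, coeff_C_mul, divMonomial, coeff_monomial, if_pos rfl]
  · intro k _ hk
    rw [coeff_C_mul, divMonomial, coeff_monomial, if_neg, mul_zero]
    intro h
    exact hk (Fin.ext (by omega))
  · simp

theorem frame_mem_degreeLT (Y : Matrix (Fin m) (Fin m) ℂ) (i : Fin m) :
    frame Y i ∈ degreeLT ℂ (2 * m) := by
  have h {k : ℕ} (hk : k < 2 * m) : divMonomial k ∈ degreeLT ℂ (2 * m) :=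
    mem_degreeLT.mpr ((degree_monomial_le _ _).trans_lt (by exact_mod_cast hk))
  refine Submodule.add_mem _ (h (by omega)) (Submodule.sum_mem _ fun l _ => ?_)
  rw [← smul_eq_C_mul]
  exact Submodule.smul_mem _ _ (h (by omega))

theorem coeff_sum_smul_frame (Y : Matrix (Fin m) (Fin m) ℂ) (a : Fin m → ℂ) (k : Fin m) :
    (∑ i, a i • frame Y i).coeff k = a k * ((k : ℕ).factorial : ℂ)⁻¹ := by
  simp only [finsetSum_coeff, coeff_smul, coeff_frame, smul_eq_mul, mul_ite, mul_zero,
    Finset.sum_ite_eq', Finset.mem_univ, if_true]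

theorem eq_of_coeff_sum_smul_frame {Y Z : Matrix (Fin m) (Fin m) ℂ} {a b : Fin m → ℂ}
    (h : ∀ k : Fin m, (∑ i, a i • frame Y i).coeff k = (∑ i, b i • frame Z i).coeff k) :
    a = b := by
  funext k
  have := h k
  rw [coeff_sum_smul_frame, coeff_sum_smul_frame] at this
  exact mul_right_cancel₀ (inv_ne_zero (by exact_mod_cast (k : ℕ).factorial_ne_zero)) this

theorem linearIndependent_frame (Y : Matrix (Fin m) (Fin m) ℂ) :
    LinearIndependent ℂ (frame Y) := by
  rw [Fintype.linearIndependent_iff]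
  intro a ha
  exact congrFun (eq_of_coeff_sum_smul_frame (Y := Y) (Z := Y) (b := 0) fun k => by simp [ha])

theorem frame_injective : Function.Injective (frame (m := m)) := by
  intro Y Z h
  ext1 i l
  have h1 := congrArg (fun f => (f i).coeff (2 * m - 1 - l)) h
  simp only [coeff_frame_reflect] at h1
  have h2 := mul_right_cancel₀ (inv_ne_zero
    (by exact_mod_cast (2 * m - 1 - l : ℕ).factorial_ne_zero)) h1
  exact mul_right_cancel₀ (pow_ne_zero _ (by norm_num)) h2

theorem span_frame_injective : Function.Injective
    fun Y : Matrix (Fin m) (Fin m) ℂ => Submodule.span ℂ (Set.range (frame Y)) := by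
  classical
  intro Y Z h
  refine frame_injective (funext fun i => ?_)
  have h1 : frame Y i ∈ Submodule.span ℂ (Set.range (frame Z)) := by
    have : frame Y i ∈ Submodule.span ℂ (Set.range (frame Y)) :=
      Submodule.subset_span (Set.mem_range_self i)
    simpa only [← h] using this
  obtain ⟨b, hb⟩ := (Submodule.mem_span_range_iff_exists_fun ℂ).mp h1
  have h2 : ∑ j, (Pi.single i 1 : Fin m → ℂ) j • frame Y j = frame Y i := by
    simp [Pi.single_apply]
  have h3 := eq_of_coeff_sum_smul_frame (Y := Y) (Z := Z) (a := Pi.single i 1) (b := b)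
    fun k => by rw [h2, hb]
  rw [← hb, ← h3]
  simp [Pi.single_apply]

theorem frame_map_conj (Y : Matrix (Fin m) (Fin m) ℂ) (i : Fin m) :
    (frame Y i).map (starRingEnd ℂ) = frame (Y.map (starRingEnd ℂ)) i := by
  simp [frame, divMonomial, Polynomial.map_sum, Polynomial.map_monomial]

end FrameLemmas

section ChartFibers

variable {m : ℕ}

theorem exists_natDegree_chartPoly (Y : Matrix (Fin m) (Fin m) ℂ) :
    ∃ g : Fin m → ℂ[X], (∀ i, g i ≠ 0) ∧ (Function.Injective fun i => (g i).natDegree) ∧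
      (∀ i, (g i).natDegree < 2 * m) ∧
      Submodule.span ℂ (Set.range g) = Submodule.span ℂ (Set.range (frame Y)) ∧
      (chartPoly (hankelCoeff m) Y).natDegree + ∑ i : Fin m, (i : ℕ) =
        ∑ i, (g i).natDegree := by
  obtain ⟨g, h0, hinj, hspan, hdeg⟩ :=
    exists_natDegree_Wr (linearIndependent_frame Y) (frame_mem_degreeLT Y)
  refine ⟨g, h0, hinj, fun i => ?_, hspan, by rw [← Wr_frame, hdeg]⟩
  have h1 : g i ∈ Submodule.span ℂ (Set.range (frame Y)) :=
    hspan ▸ Submodule.subset_span (Set.mem_range_self i)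
  have h2 : Submodule.span ℂ (Set.range (frame Y)) ≤ degreeLT ℂ (2 * m) := by
    rw [Submodule.span_le]
    rintro _ ⟨i, rfl⟩
    exact frame_mem_degreeLT Y i
  exact (natDegree_lt_iff_degree_lt (h0 i)).mpr (mem_degreeLT.mp (h2 h1))

theorem natDegree_chartPoly_le (Y : Matrix (Fin m) (Fin m) ℂ) :
    (chartPoly (hankelCoeff m) Y).natDegree ≤ m ^ 2 := by
  obtain ⟨g, -, hinj, hlt, -, hdeg⟩ := exists_natDegree_chartPoly Y
  have := sum_le_sq_add_sum_fin hinj hlt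
  omega

theorem eq_zero_of_natDegree_chartPoly {Y : Matrix (Fin m) (Fin m) ℂ}
    (h : (chartPoly (hankelCoeff m) Y).natDegree = 0) : Y = 0 := by
  obtain ⟨g, -, hinj, -, hspan, hdeg⟩ := exists_natDegree_chartPoly Y
  have h1 := sum_fin_add_card_le_sum hinj
  have h2 : (Finset.univ.filter fun i => m ≤ (g i).natDegree).card = 0 := by omega
  rw [Finset.card_eq_zero, Finset.filter_eq_empty_iff] at h2
  have h3 : Submodule.span ℂ (Set.range (frame Y)) ≤ degreeLT ℂ m := by
    rw [← hspan, Submodule.span_le]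
    rintro _ ⟨i, rfl⟩
    refine mem_degreeLT.mpr ((degree_le_natDegree).trans_lt ?_)
    exact_mod_cast not_le.mp (h2 (Finset.mem_univ i))
  ext1 i l
  have h4 := mem_degreeLT.mp (h3 (Submodule.subset_span (Set.mem_range_self i)))
  have h5 : (frame Y i).coeff (2 * m - 1 - l) = 0 :=
    coeff_eq_zero_of_degree_lt (h4.trans_le (by exact_mod_cast (by omega)))
  rw [coeff_frame_reflect, mul_eq_zero, mul_eq_zero] at h5
  rcases h5 with (h5 | h5) | h5
  · exact h5
  · exact absurd h5 (pow_ne_zero _ (by norm_num))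
  · exact absurd h5 (inv_ne_zero (by exact_mod_cast (2 * m - 1 - l : ℕ).factorial_ne_zero))

theorem natDegree_chartPoly_add_two_ne_sq {Y : Matrix (Fin m) (Fin m) ℂ}
    (hY : ∀ p ∈ Submodule.span ℂ (Set.range (frame Y)), ∃ q ∈
      Submodule.span ℂ (Set.range (frame Y.transpose)), q.degree = p.degree) :
    (chartPoly (hankelCoeff m) Y).natDegree + 2 ≠ m ^ 2 := by
  obtain ⟨g, h0, hinj, hlt, hspan, hdeg⟩ := exists_natDegree_chartPoly Y
  have hmem (i : Fin m) : g i ∈ Submodule.span ℂ (Set.range (frame Y)) :=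
    hspan ▸ Submodule.subset_span (Set.mem_range_self i)
  have h1 := sum_add_two_ne_of_add_ne hinj hlt fun i j hij => by
    obtain ⟨q, hq, hqd⟩ := hY _ (hmem j)
    have hq0 : q ≠ 0 := by
      rintro rfl
      rw [degree_zero] at hqd
      exact h0 j (degree_eq_bot.mp hqd.symm)
    refine skewForm_ne_zero (h0 i) hq0 (hlt i) ?_ (skewForm_span_frame Y (hmem i) hq)
    rw [natDegree_eq_of_degree_eq hqd, hij]
  omega

theorem natDegree_chartPoly_add_two_ne_of_transpose_eq {Y : Matrix (Fin m) (Fin m) ℂ}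
    (hY : Y.transpose = Y) : (chartPoly (hankelCoeff m) Y).natDegree + 2 ≠ m ^ 2 :=
  natDegree_chartPoly_add_two_ne_sq fun p hp => ⟨p, by rwa [hY], rfl⟩

theorem map_conj_mem_span_frame {Y : Matrix (Fin m) (Fin m) ℂ} {p : ℂ[X]}
    (hp : p ∈ Submodule.span ℂ (Set.range (frame Y))) :
    p.map (starRingEnd ℂ) ∈ Submodule.span ℂ (Set.range (frame (Y.map (starRingEnd ℂ)))) := by
  obtain ⟨a, rfl⟩ := (Submodule.mem_span_range_iff_exists_fun ℂ).mp hp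
  simp only [Polynomial.map_sum, Polynomial.map_smul, frame_map_conj]
  exact Submodule.sum_mem _ fun i _ =>
    Submodule.smul_mem _ _ (Submodule.subset_span (Set.mem_range_self i))

theorem natDegree_chartPoly_add_two_ne_of_transpose_eq_conj {Y : Matrix (Fin m) (Fin m) ℂ}
    (hY : Y.transpose = Y.map (starRingEnd ℂ)) :
    (chartPoly (hankelCoeff m) Y).natDegree + 2 ≠ m ^ 2 :=
  natDegree_chartPoly_add_two_ne_sq fun p hp => ⟨p.map (starRingEnd ℂ), by
    rw [hY]
    exact map_conj_mem_span_frame hp, degree_map _ _⟩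

end ChartFibers

section ChartCount

variable {m : ℕ}

theorem prod_weight_mul_prod_factorial (m : ℕ) :
    (∏ p : Fin m × Fin m, (2 * m - 1 - p.1 - p.2)) * ∏ i ∈ Finset.range m, i.factorial =
      ∏ i ∈ Finset.range m, (m + i).factorial := by
  have h1 (i : Fin m) : ∏ j : Fin m, (2 * m - 1 - i - j) = (2 * m - 1 - i).descFactorial m := by
    rw [Fin.prod_univ_eq_prod_range (fun j => 2 * m - 1 - i - j), Nat.descFactorial_eq_prod_range]
  rw [Fintype.prod_prod_type]
  simp only [h1]
  rw [Fin.prod_univ_eq_prod_range (fun i => (2 * m - 1 - i).descFactorial m),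
    ← Finset.prod_range_reflect, ← Finset.prod_mul_distrib]
  refine Finset.prod_congr rfl fun i hi => ?_
  rw [Finset.mem_range] at hi
  have := Nat.factorial_mul_descFactorial (show m ≤ m + i by omega)
  rw [← this, show 2 * m - 1 - (m - 1 - i) = m + i by omega, Nat.add_sub_cancel_left, mul_comm]

theorem prod_succ_lt_of_eq_div {N : ℕ}
    (hN : N = (Nat.factorial (m ^ 2) * ∏ i ∈ Finset.range m, Nat.factorial i) /
      ∏ i ∈ Finset.range m, Nat.factorial (m + i)) :
    ∏ i : Fin (m ^ 2), ((i : ℕ) + 1) < (N + 1) * ∏ p : Fin m × Fin m, (2 * m - 1 - p.1 - p.2) := by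
  have hpos : 0 < ∏ i ∈ Finset.range m, i.factorial :=
    Finset.prod_pos fun i _ => i.factorial_pos
  rw [← prod_weight_mul_prod_factorial, Nat.mul_div_mul_right _ _ hpos] at hN
  rw [Fin.prod_univ_eq_prod_range (fun i => i + 1), Finset.prod_range_add_one_eq_factorial, hN,
    mul_comm]
  exact Nat.lt_mul_div_succ _ (Finset.prod_pos fun p _ => by omega)

/-- The number of real points in a chart fiber with the maximal number of points. -/
theorem ncard_real_chartPoly_fiber_modEq (hm : 3 ≤ m) {N : ℕ}
    (hN : N = (Nat.factorial (m ^ 2) * ∏ i ∈ Finset.range m, Nat.factorial i) /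
      ∏ i ∈ Finset.range m, Nat.factorial (m + i)) {w : Fin (m ^ 2) → ℝ}
    (hw : {x : Fin m × Fin m → ℂ | ∀ k : Fin (m ^ 2),
      (chartPoly (hankelCoeff m) (Matrix.of fun i j => x (i, j))).coeff (k + 1) = w k}.ncard = N) :
    {x : Fin m × Fin m → ℂ | (∀ k : Fin (m ^ 2),
      (chartPoly (hankelCoeff m) (Matrix.of fun i j => x (i, j))).coeff (k + 1) = w k) ∧
      ∀ p, (starRingEnd ℂ) (x p) = x p}.ncard ≡ N [MOD 4] := by
  classical
  have hm2 : 3 ≤ m ^ 2 := by nlinarith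
  have hdeg (Y : Matrix (Fin m) (Fin m) ℂ) (n : ℕ) (hn : n ≤ m ^ 2)
      (h : ∀ k, n < k → k ≤ m ^ 2 → (chartPoly (hankelCoeff m) Y).coeff k = 0) :
      (chartPoly (hankelCoeff m) Y).natDegree ≤ n := by
    refine natDegree_le_iff_coeff_eq_zero.mpr fun k hk => ?_
    by_cases hkm : k ≤ m ^ 2
    · exact h k hk hkm
    · exact coeff_eq_zero_of_natDegree_lt ((natDegree_chartPoly_le Y).trans_lt (by omega))
  simp only [← aeval_coeff_chartPoly] at hw ⊢
  refine ncard_real_fiber_modEq (s := Prod.swap) (κ := Sym2 (Fin m))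
    (q := fun p => s(p.1, p.2)) (h := fun p => 2 * m - 1 - p.1 - p.2)
    (k := fun k : Fin (m ^ 2) => (k : ℕ) + 1)
    (w₀ := fun k => if (k : ℕ) + 3 = m ^ 2 then 1 else 0)
    (W := fun k : Fin (m ^ 2) => (chartPoly (hankelCoeff m) (genericMatrix m)).coeff (k + 1))
    (fun p => by omega) (fun k => Nat.succ_pos _)
    (fun k => isWeightedHomogeneous_coeff_chartPoly _ _) ?_ ?_ (fun p => p.swap_swap) ?_
    (fun k => rename_swap_coeff_chartPoly (hankelCoeff_transpose m) _) ?_ ?_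
    (prod_succ_lt_of_eq_div hN) hw ?_
  · intro x hx
    simp only [aeval_coeff_chartPoly] at hx
    have h1 := eq_zero_of_natDegree_chartPoly (Nat.le_zero.mp
      (hdeg (Matrix.of fun i j => x (i, j)) 0 (Nat.zero_le _) fun k hk hkm => by
        have := hx ⟨k - 1, by omega⟩
        rwa [Nat.sub_add_cancel hk] at this))
    funext p
    exact congrFun (congrFun h1 p.1) p.2
  · rw [Fintype.card_fin, Fintype.card_prod, Fintype.card_fin, sq]
  · refine ⟨(⟨0, by omega⟩, ⟨1, by omega⟩), ?_⟩
    simp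
  · intro x hx
    refine ⟨Sym2.lift ⟨fun i j => x (i, j), fun i j => (congrFun hx (j, i))⟩, ?_⟩
    funext p
    rfl
  · rw [Sym2.card, Fintype.card_fin, Fintype.card_fin, Nat.choose_two_right, Nat.add_sub_cancel]
    have : (m + 1) * m / 2 * 2 ≤ (m + 1) * m := Nat.div_mul_le_self _ _
    nlinarith
  · intro x hx
    simp only [aeval_coeff_chartPoly] at hx
    set Y : Matrix (Fin m) (Fin m) ℂ := Matrix.of fun i j => x (i, j) with hY
    have hd : (chartPoly (hankelCoeff m) Y).natDegree = m ^ 2 - 2 := by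
      refine natDegree_eq_of_le_of_coeff_ne_zero ?_ ?_
      · refine hdeg Y _ (Nat.sub_le _ _) fun k hk hkm => ?_
        have := hx ⟨k - 1, by omega⟩
        rw [Nat.sub_add_cancel (by omega), if_neg (by simp only; omega)] at this
        simpa using this
      · have := hx ⟨m ^ 2 - 3, by omega⟩
        rw [if_pos (by simp only; omega), show m ^ 2 - 3 + 1 = m ^ 2 - 2 by omega] at this
        rw [this]
        norm_num
    constructor
    · intro hs
      refine natDegree_chartPoly_add_two_ne_of_transpose_eq (Y := Y) ?_ (by omega)
      ext1 i j
      exact congrFun hs (i, j)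
    · intro hs
      refine natDegree_chartPoly_add_two_ne_of_transpose_eq_conj (Y := Y) ?_ (by omega)
      ext1 i j
      have := congrFun hs (j, i)
      simp only [Prod.swap_prod_mk] at this
      simpa [hY] using this.symm

end ChartCount

section Translation

variable {m : ℕ}

theorem derivative_taylor {R : Type*} [CommRing R] (r : R) (p : R[X]) :
    derivative (taylor r p) = taylor r (derivative p) := by
  simp [taylor_apply, derivative_comp]

theorem Wr_taylor {K : Type*} [CommRing K] (r : K) (f : Fin m → K[X]) :
    Wr (fun i => taylor r (f i)) = taylor r (Wr f) := by
  have h : ∀ (k : ℕ) (p : K[X]), derivative^[k] (taylor r p) = taylor r (derivative^[k] p) :=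
    fun k p => (Function.Commute.iterate_left (f := derivative) (g := taylor r)
      (fun p => derivative_taylor r p) k p)
  have h2 : taylor r (Wr f) = (taylorAlgHom r : K[X] →+* K[X]) (Wr f) := rfl
  rw [h2, Wr, Wr, RingHom.map_det]
  congr 1
  ext1 i j
  exact h i (f j)

theorem taylor_mem_degreeLT {r : ℂ} {p : ℂ[X]} {n : ℕ} (hp : p ∈ degreeLT ℂ n) :
    taylor r p ∈ degreeLT ℂ n := by
  rwa [mem_degreeLT, degree_taylor, ← mem_degreeLT]

theorem image_map_conj_span {ι : Type*} [Fintype ι] (f : ι → ℂ[X]) :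
    (fun p : ℂ[X] => p.map (starRingEnd ℂ)) '' (Submodule.span ℂ (Set.range f) : Set ℂ[X]) =
      (Submodule.span ℂ (Set.range fun i => (f i).map (starRingEnd ℂ)) : Set ℂ[X]) := by
  ext q
  simp only [Set.mem_image, SetLike.mem_coe, Submodule.mem_span_range_iff_exists_fun]
  constructor
  · rintro ⟨_, ⟨a, rfl⟩, rfl⟩
    exact ⟨fun i => (starRingEnd ℂ) (a i), by simp only [Polynomial.map_sum, Polynomial.map_smul]⟩
  · rintro ⟨a, rfl⟩
    refine ⟨_, ⟨fun i => (starRingEnd ℂ) (a i), rfl⟩, ?_⟩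
    simp only [Polynomial.map_sum, Polynomial.map_smul, Complex.conj_conj]

theorem exists_eq_frame {h : Fin m → ℂ[X]} (hdeg : ∀ i, h i ∈ degreeLT ℂ (2 * m))
    (hco : ∀ i k : Fin m, (h i).coeff k = if i = k then ((i : ℕ).factorial : ℂ)⁻¹ else 0) :
    ∃ Y : Matrix (Fin m) (Fin m) ℂ, h = frame Y := by
  refine ⟨Matrix.of fun i l =>
    (h i).coeff (2 * m - 1 - l) * (2 * m - 1 - l : ℕ).factorial * (-1) ^ (l : ℕ), ?_⟩
  funext i
  ext n
  rcases lt_or_ge n m with hn | hn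
  · exact (hco i ⟨n, hn⟩).trans (coeff_frame _ i ⟨n, hn⟩).symm
  rcases lt_or_ge n (2 * m) with hn2 | hn2
  · have h1 := coeff_frame_reflect (Matrix.of fun i l : Fin m =>
      (h i).coeff (2 * m - 1 - l) * (2 * m - 1 - l : ℕ).factorial * (-1) ^ (l : ℕ)) i
      ⟨2 * m - 1 - n, by omega⟩
    have h2 : 2 * m - 1 - (2 * m - 1 - n) = n := by omega
    simp only [Matrix.of_apply, h2] at h1
    rw [h1]
    have h3 : (n.factorial : ℂ) ≠ 0 := by exact_mod_cast n.factorial_ne_zero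
    have h4 : ((-1 : ℂ) ^ (2 * m - 1 - n)) * (-1) ^ (2 * m - 1 - n) = 1 := by
      rw [← mul_pow]
      norm_num
    rw [mul_assoc (_ * _) _ ((-1 : ℂ) ^ _), h4, mul_one, mul_inv_cancel_right₀ h3]
  · rw [coeff_eq_zero_of_degree_lt ((mem_degreeLT.mp (hdeg i)).trans_le (by exact_mod_cast hn2)),
      coeff_eq_zero_of_degree_lt
        ((mem_degreeLT.mp (frame_mem_degreeLT _ i)).trans_le (by exact_mod_cast hn2))]

/-- A space whose Wronskian does not vanish at the origin lies in the chart. -/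
theorem exists_span_frame_eq {g : Fin m → ℂ[X]} (hdeg : ∀ i, g i ∈ degreeLT ℂ (2 * m))
    (h0 : (Wr g).coeff 0 ≠ 0) :
    ∃ Y : Matrix (Fin m) (Fin m) ℂ,
      Submodule.span ℂ (Set.range (frame Y)) = Submodule.span ℂ (Set.range g) := by
  set B : Matrix (Fin m) (Fin m) ℂ :=
    Matrix.of fun i j => ((i : ℕ).factorial : ℂ) * (g j).coeff i with hB
  have hdet : (Wr g).coeff 0 = B.det := by
    rw [coeff_zero_eq_eval_zero, Wr, ← coe_evalRingHom, RingHom.map_det]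
    congr 1
    ext1 i j
    simp only [RingHom.mapMatrix_apply, Matrix.map_apply, Matrix.of_apply, coe_evalRingHom, hB]
    rw [← coeff_zero_eq_eval_zero, coeff_iterate_derivative, zero_add, Nat.descFactorial_self,
      nsmul_eq_mul]
  have hunit : IsUnit B.det := isUnit_iff_ne_zero.mpr (hdet ▸ h0)
  set h : Fin m → ℂ[X] := fun j => ∑ k, B⁻¹ k j • g k with hh
  have hle : Submodule.span ℂ (Set.range h) ≤ Submodule.span ℂ (Set.range g) := by
    rw [Submodule.span_le]
    rintro _ ⟨i, rfl⟩
    exact Submodule.sum_mem _ fun k _ =>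
      Submodule.smul_mem _ _ (Submodule.subset_span (Set.mem_range_self k))
  obtain ⟨Y, hY⟩ := exists_eq_frame (h := h)
    (fun i => Submodule.sum_mem _ fun k _ => Submodule.smul_mem _ _ (hdeg k)) fun j i => by
      have h1 : (B * B⁻¹) i j = (i : ℕ).factorial * (h j).coeff i := by
        rw [Matrix.mul_apply, hh, finsetSum_coeff, Finset.mul_sum]
        refine Finset.sum_congr rfl fun k _ => ?_
        rw [coeff_smul, smul_eq_mul, hB, Matrix.of_apply]
        ring
      have h2 : ((i : ℕ).factorial : ℂ) ≠ 0 := by exact_mod_cast (i : ℕ).factorial_ne_zero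
      rw [Matrix.mul_nonsing_inv _ hunit, Matrix.one_apply] at h1
      split_ifs with hij
      · subst hij
        rw [if_pos rfl] at h1
        exact (inv_eq_of_mul_eq_one_right h1.symm).symm
      · rw [if_neg (Ne.symm hij)] at h1
        exact (mul_eq_zero.mp h1.symm).resolve_left h2
  refine ⟨Y, ?_⟩
  rw [hY] at hle
  have hfd : FiniteDimensional ℂ (Submodule.span ℂ (Set.range g)) :=
    FiniteDimensional.span_of_finite ℂ (Set.finite_range g)
  refine Submodule.eq_of_le_of_finrank_le hle ?_
  rw [finrank_span_eq_card (linearIndependent_frame Y)]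
  exact finrank_range_le_card g

/-- The translates to the point `a` of the frame with chart coordinates `x`. -/
noncomputable def translatedFrame (a : ℂ) (x : Fin m × Fin m → ℂ) (i : Fin m) : ℂ[X] :=
  taylor (-a) (frame (Matrix.of fun i j => x (i, j)) i)

theorem span_translatedFrame (a : ℂ) (x : Fin m × Fin m → ℂ) :
    Submodule.span ℂ (Set.range (translatedFrame a x)) =
      (Submodule.span ℂ (Set.range (frame (Matrix.of fun i j => x (i, j))))).map
        (taylor (-a)) := by
  rw [Submodule.map_span, ← Set.range_comp]
  rfl

theorem span_translatedFrame_injective (a : ℂ) : Function.Injective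
    fun x : Fin m × Fin m → ℂ => Submodule.span ℂ (Set.range (translatedFrame a x)) := by
  intro x y hxy
  simp only [span_translatedFrame] at hxy
  have h := span_frame_injective (Submodule.map_injective_of_injective (taylor_injective (-a)) hxy)
  funext p
  exact congrFun (congrFun h p.1) p.2

theorem linearIndependent_translatedFrame (a : ℂ) (x : Fin m × Fin m → ℂ) :
    LinearIndependent ℂ (translatedFrame a x) :=
  (linearIndependent_frame _).map' (taylor (-a))
    (LinearMap.ker_eq_bot.mpr (taylor_injective (-a)))

theorem translatedFrame_map_conj (a : ℝ) (x : Fin m × Fin m → ℂ) (i : Fin m) :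
    (translatedFrame a x i).map (starRingEnd ℂ) =
      translatedFrame a (fun p => (starRingEnd ℂ) (x p)) i := by
  rw [translatedFrame, map_taylor, frame_map_conj, map_neg, Complex.conj_ofReal]
  rfl

theorem image_map_conj_span_translatedFrame_eq_iff (a : ℝ) (x : Fin m × Fin m → ℂ) :
    (fun p : ℂ[X] => p.map (starRingEnd ℂ)) ''
        (Submodule.span ℂ (Set.range (translatedFrame a x)) : Set ℂ[X]) =
        (Submodule.span ℂ (Set.range (translatedFrame a x)) : Set ℂ[X]) ↔
      ∀ p, (starRingEnd ℂ) (x p) = x p := by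
  rw [image_map_conj_span]
  simp only [translatedFrame_map_conj, SetLike.coe_set_eq]
  constructor
  · intro h p
    exact congrFun (span_translatedFrame_injective (a : ℂ) h) p
  · intro h
    rw [funext h]

end Translation

section Fibers

variable {m : ℕ}

/-- The spaces in the Wronski fiber over `Φ` are the spans of the translated frames in the
corresponding chart fiber. -/
theorem mem_wronski_fiber_iff {Φ : ℝ[X]} (hdeg : Φ.natDegree ≤ m ^ 2) {a : ℝ} (ha : Φ.eval a ≠ 0)
    (H : Submodule ℂ ℂ[X]) :
    (H ≤ degreeLT ℂ (2 * m) ∧ Module.finrank ℂ H = m ∧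
      ∃ f : Fin m → ℂ[X], LinearIndependent ℂ f ∧ Submodule.span ℂ (Set.range f) = H ∧
        ∃ c : ℂ, c ≠ 0 ∧ Wr f = c • Φ.map (algebraMap ℝ ℂ)) ↔
    ∃ x : Fin m × Fin m → ℂ, (∀ k : Fin (m ^ 2),
      (chartPoly (hankelCoeff m) (Matrix.of fun i j => x (i, j))).coeff (k + 1) =
        ((taylor a Φ).coeff (k + 1) / Φ.eval a : ℝ)) ∧
      Submodule.span ℂ (Set.range (translatedFrame a x)) = H := by
  have hmap : taylor (a : ℂ) (Φ.map (algebraMap ℝ ℂ)) = (taylor a Φ).map (algebraMap ℝ ℂ) := by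
    rw [map_taylor]
    rfl
  have haC : ((Φ.eval a : ℝ) : ℂ) ≠ 0 := by exact_mod_cast ha
  constructor
  · rintro ⟨hH, -, f, hf, hspan, c, hc, hW⟩
    have hfH (i : Fin m) : f i ∈ degreeLT ℂ (2 * m) :=
      hH (hspan ▸ Submodule.subset_span (Set.mem_range_self i))
    have hWg : Wr (fun i => taylor (a : ℂ) (f i)) = C c * (taylor a Φ).map (algebraMap ℝ ℂ) := by
      rw [Wr_taylor, hW, map_smul, hmap, smul_eq_C_mul]
    have hWg0 : (Wr (fun i => taylor (a : ℂ) (f i))).coeff 0 = c * Φ.eval a := by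
      rw [hWg, coeff_C_mul, coeff_map, taylor_coeff_zero]
      rfl
    obtain ⟨Y, hY⟩ := exists_span_frame_eq (g := fun i => taylor (a : ℂ) (f i))
      (fun i => taylor_mem_degreeLT (hfH i)) (by rw [hWg0]; exact mul_ne_zero hc haC)
    obtain ⟨b, hb⟩ := Wr_eq_C_mul (f := frame Y) (g := fun i => taylor (a : ℂ) (f i)) fun i => by
      rw [← hY]
      exact Submodule.subset_span (Set.mem_range_self i)
    rw [Wr_frame] at hb
    have hb0 : 1 = b * (c * Φ.eval a) := by
      rw [← hWg0, ← coeff_C_mul, ← hb, coeff_zero_chartPoly]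
    refine ⟨fun p => Y p.1 p.2, fun k => ?_, ?_⟩
    · have h1 := congrArg (fun p => p.coeff (k + 1)) hb
      simp only [hWg, coeff_C_mul, coeff_map, Complex.coe_algebraMap] at h1
      rw [Complex.ofReal_div, eq_div_iff haC]
      refine Eq.trans (congrArg (· * ((Φ.eval a : ℝ) : ℂ)) h1) ?_
      linear_combination (-((taylor a Φ).coeff (k + 1) : ℂ)) * hb0
    · rw [span_translatedFrame]
      refine Eq.trans (congrArg (Submodule.map (taylor (-(a : ℂ)))) hY) ?_
      rw [Submodule.map_span, ← Set.range_comp, ← hspan]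
      congr 2
      funext i
      simp [taylor_taylor]
  · rintro ⟨x, hx, rfl⟩
    have hLI := linearIndependent_translatedFrame (a : ℂ) x
    refine ⟨?_, by rw [finrank_span_eq_card hLI, Fintype.card_fin], translatedFrame a x, hLI, rfl,
      ((Φ.eval a : ℝ) : ℂ)⁻¹, inv_ne_zero haC, ?_⟩
    · rw [Submodule.span_le]
      rintro _ ⟨i, rfl⟩
      exact taylor_mem_degreeLT (frame_mem_degreeLT _ i)
    · have h1 : chartPoly (hankelCoeff m) (Matrix.of fun i j => x (i, j)) =
          ((Φ.eval a : ℝ) : ℂ)⁻¹ • taylor (a : ℂ) (Φ.map (algebraMap ℝ ℂ)) := by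
        ext n
        rw [hmap, coeff_smul, coeff_map, smul_eq_mul]
        rcases Nat.eq_zero_or_pos n with rfl | hn
        · rw [coeff_zero_chartPoly, taylor_coeff_zero]
          exact (inv_mul_cancel₀ haC).symm
        by_cases hnm : n ≤ m ^ 2
        · have h2 := hx ⟨n - 1, by omega⟩
          simp only [Nat.sub_add_cancel hn] at h2
          rw [h2, Complex.ofReal_div, div_eq_inv_mul]
          rfl
        · rw [coeff_eq_zero_of_natDegree_lt
              ((natDegree_chartPoly_le _).trans_lt (not_le.mp hnm)),
            coeff_eq_zero_of_natDegree_lt (p := taylor a Φ)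
              (by rw [natDegree_taylor]; omega), map_zero, mul_zero]
      have h2 : Wr (translatedFrame a x) = taylor (-(a : ℂ))
          (Wr (frame (Matrix.of fun i j => x (i, j)))) := Wr_taylor _ _
      rw [h2, Wr_frame, h1, map_smul, taylor_taylor, neg_add_cancel, taylor_zero]

end Fibers

/-- **Theorem (Wronski fibers mod 4).**  Let `m ≥ 3` and let
`N = (m²)!·1!·2!⋯(m−1)! / (m!·(m+1)!⋯(2m−1)!)` be the degree of the Wronski map.  If `Φ` is a
nonzero real polynomial of degree at most `m²` and the fiber `S` of the Wronski map over `Φ`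
(the set of `m`-dimensional subspaces of polynomials of degree at most `2m−1` whose Wronskian
is a nonzero scalar multiple of `Φ`) consists of exactly `N` points, then the number of members
of `S` stable under coefficientwise complex conjugation is congruent to `N` modulo `4`. -/
theorem wronski_fiber_mod_four (m : ℕ) (hm : 3 ≤ m) (N : ℕ)
    (hN : N = (Nat.factorial (m ^ 2) * ∏ i ∈ Finset.range m, Nat.factorial i) /
      ∏ i ∈ Finset.range m, Nat.factorial (m + i))
    (Φ : ℝ[X]) (hΦ : Φ ≠ 0) (hdeg : Φ.natDegree ≤ m ^ 2)
    (S : Set (Submodule ℂ ℂ[X]))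
    (hS : S = {H | H ≤ degreeLT ℂ (2 * m) ∧ Module.finrank ℂ H = m ∧
        ∃ f : Fin m → ℂ[X], LinearIndependent ℂ f ∧ Submodule.span ℂ (Set.range f) = H ∧
          ∃ c : ℂ, c ≠ 0 ∧ Wr f = c • Φ.map (algebraMap ℝ ℂ)})
    (hfin : S.Finite) (hcard : S.ncard = N) :
    {H ∈ S | (fun p : ℂ[X] => p.map (starRingEnd ℂ)) '' (H : Set ℂ[X]) = (H : Set ℂ[X])}.ncard
      ≡ N [MOD 4] := by
  obtain ⟨a, ha⟩ : ∃ a : ℝ, Φ.eval a ≠ 0 := by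
    by_contra! h
    exact hΦ (Polynomial.funext fun a => by rw [h a, eval_zero])
  set F : Set (Fin m × Fin m → ℂ) := {x | ∀ k : Fin (m ^ 2),
    (chartPoly (hankelCoeff m) (Matrix.of fun i j => x (i, j))).coeff (k + 1) =
      ((taylor a Φ).coeff (k + 1) / Φ.eval a : ℝ)} with hF
  have hSF : S = (fun x => Submodule.span ℂ (Set.range (translatedFrame (a : ℂ) x))) '' F := by
    rw [hS]
    ext H
    exact mem_wronski_fiber_iff hdeg ha H
  have hinj := span_translatedFrame_injective (m := m) (a : ℂ)
  have hreal : {H ∈ S | (fun p : ℂ[X] => p.map (starRingEnd ℂ)) '' (H : Set ℂ[X]) =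
      (H : Set ℂ[X])} = (fun x => Submodule.span ℂ (Set.range (translatedFrame (a : ℂ) x))) ''
        {x | x ∈ F ∧ ∀ p, (starRingEnd ℂ) (x p) = x p} := by
    ext H
    rw [hSF]
    constructor
    · rintro ⟨⟨x, hx, rfl⟩, hH⟩
      exact ⟨x, ⟨hx, (image_map_conj_span_translatedFrame_eq_iff a x).mp hH⟩, rfl⟩
    · rintro ⟨x, ⟨hx, hr⟩, rfl⟩
      exact ⟨⟨x, hx, rfl⟩, (image_map_conj_span_translatedFrame_eq_iff a x).mpr hr⟩
  rw [hSF, Set.ncard_image_of_injective _ hinj] at hcard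
  rw [hreal, Set.ncard_image_of_injective _ hinj]
  exact ncard_real_chartPoly_fiber_modEq hm hN hcard
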